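/- arXiv:math/0408030 — 2 statements merged into one kernel-verified Lean document; each statement's English description precedes it below -/
import Mathlib

section
/- For all N ≥ 2 and all nonnegative measurable functions f_1,...,f_N on [-1,1], the integral over the unit sphere S^{N-1} (with uniform probability measure μ) of the product ∏_{j=1}^N f_j(v_j) is at most ∏_{j=1}^N ‖f_j‖_{L²(S^{N-1})}, where v_j is the j-th coordinate function. -/
open MeasureTheory ENNReal

/-- The uniform Borel probability measure on the unit sphere `S^{N-1} ⊆ ℝ^N`. -/
noncomputable def sphereUniform (N : ℕ) :
    Measure (Metric.sphere (0 : EuclideanSpace ℝ (Fin N)) 1) :=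
  ((volume : Measure (EuclideanSpace ℝ (Fin N))).toSphere Set.univ)⁻¹ •
    (volume : Measure (EuclideanSpace ℝ (Fin N))).toSphere

open Polynomial Topology Filter Set

/-! ### Rotations of coordinate planes -/

/-- The unit sphere of `ℝ^N`. -/
local notation "𝕊" N => Metric.sphere (0 : EuclideanSpace ℝ (Fin N)) 1

theorem sphereUniform_isProbabilityMeasure {N : ℕ} (hN : 2 ≤ N) :
    IsProbabilityMeasure (sphereUniform N) := by
  have : Nonempty (Fin N) := ⟨⟨0, by omega⟩⟩
  refine ⟨?_⟩
  rw [sphereUniform, Measure.smul_apply, smul_eq_mul]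
  refine ENNReal.inv_mul_cancel ?_ (measure_ne_top _ _)
  rw [Ne, Measure.measure_univ_eq_zero]
  exact Measure.toSphere_ne_zero _

open scoped Pointwise in
theorem toSphere_measurePreserving {E : Type*} [NormedAddCommGroup E] [NormedSpace ℝ E]
    [MeasurableSpace E] [BorelSpace E] (μ : Measure E) (e : E ≃ₗᵢ[ℝ] E)
    (he : MeasurePreserving e μ μ) (φ : Metric.sphere (0 : E) 1 → Metric.sphere (0 : E) 1)
    (hφ : ∀ v, (φ v : E) = e v) : MeasurePreserving φ μ.toSphere μ.toSphere := by
  have hc : Continuous φ := by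
    refine Continuous.subtype_mk (f := fun v => (φ v : E)) ?_ (fun v => (φ v).2)
    simp only [hφ]
    exact e.continuous.comp continuous_subtype_val
  refine ⟨hc.measurable, Measure.ext fun s hs => ?_⟩
  rw [Measure.map_apply hc.measurable hs, μ.toSphere_apply' (hc.measurable hs),
    μ.toSphere_apply' hs]
  congr 1
  have hemb : MeasurableEmbedding e := e.toHomeomorph.measurableEmbedding
  rw [← he.measure_preimage_emb hemb (Ioo (0 : ℝ) 1 • (Subtype.val '' s))]
  congr 1
  ext x
  simp only [mem_preimage, Set.mem_smul, mem_image]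
  constructor
  · rintro ⟨r, hr, _, ⟨v, hv, rfl⟩, rfl⟩
    exact ⟨r, hr, φ v, ⟨φ v, hv, rfl⟩, by simp [hφ]⟩
  · rintro ⟨r, hr, _, ⟨v, hv, rfl⟩, hx⟩
    have hw : e.symm v ∈ Metric.sphere (0 : E) 1 := by simp
    refine ⟨r, hr, e.symm v, ⟨⟨e.symm v, hw⟩, ?_, rfl⟩, ?_⟩
    · have : φ ⟨e.symm v, hw⟩ = v := Subtype.ext (by simp [hφ])
      rwa [this]
    · rw [← map_smul, LinearIsometryEquiv.symm_apply_eq]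
      exact hx

/-- Rotation by the angle `s` in the plane of the coordinates `i` and `k`. -/
noncomputable def planeRotation {N : ℕ} (i k : Fin N) (s : ℝ) :
    EuclideanSpace ℝ (Fin N) →ₗ[ℝ] EuclideanSpace ℝ (Fin N) where
  toFun v := WithLp.toLp 2 fun m =>
    if m = k then Real.cos s * v k + Real.sin s * v i
    else if m = i then Real.cos s * v i - Real.sin s * v k else v m
  map_add' v w := by
    ext m
    simp only [PiLp.add_apply]
    split_ifs <;> ring
  map_smul' c v := by
    ext m
    simp only [PiLp.smul_apply, smul_eq_mul, RingHom.id_apply]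
    split_ifs <;> ring

theorem planeRotation_apply {N : ℕ} (i k : Fin N) (s : ℝ) (v : EuclideanSpace ℝ (Fin N))
    (m : Fin N) : planeRotation i k s v m =
      if m = k then Real.cos s * v k + Real.sin s * v i
      else if m = i then Real.cos s * v i - Real.sin s * v k else v m := rfl

theorem norm_planeRotation {N : ℕ} {i k : Fin N} (hik : i ≠ k) (s : ℝ)
    (v : EuclideanSpace ℝ (Fin N)) : ‖planeRotation i k s v‖ = ‖v‖ := by
  rw [EuclideanSpace.norm_eq, EuclideanSpace.norm_eq]
  congr 1
  simp only [Real.norm_eq_abs, sq_abs, planeRotation_apply]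
  rw [← Finset.add_sum_erase _ _ (Finset.mem_univ k),
    ← Finset.add_sum_erase (Finset.univ.erase k) _ (a := i) (by simp [hik]),
    ← Finset.add_sum_erase _ (fun m => v m ^ 2) (Finset.mem_univ k),
    ← Finset.add_sum_erase (Finset.univ.erase k) (fun m => v m ^ 2) (a := i) (by simp [hik])]
  rw [Finset.sum_congr rfl (g := fun m => v m ^ 2)]
  · simp only [if_true, if_neg hik]
    linear_combination (v k ^ 2 + v i ^ 2) * Real.sin_sq_add_cos_sq s
  · intro m hm
    simp only [Finset.mem_erase] at hm
    simp [hm.1, hm.2.1]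

/-- Rotation of the unit sphere by the angle `s` in the plane of the coordinates `i` and `k`. -/
noncomputable def sphereRotation {N : ℕ} {i k : Fin N} (hik : i ≠ k) (s : ℝ) (v : 𝕊 N) : 𝕊 N :=
  ⟨planeRotation i k s v, by simp [norm_planeRotation hik]⟩

theorem coe_sphereRotation {N : ℕ} {i k : Fin N} (hik : i ≠ k) (s : ℝ) (v : 𝕊 N) :
    (sphereRotation hik s v : EuclideanSpace ℝ (Fin N)) = planeRotation i k s v := rfl

theorem measurePreserving_sphereRotation {N : ℕ} {i k : Fin N} (hik : i ≠ k) (s : ℝ) :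
    MeasurePreserving (sphereRotation hik s) (sphereUniform N) (sphereUniform N) := by
  let e : EuclideanSpace ℝ (Fin N) ≃ₗᵢ[ℝ] EuclideanSpace ℝ (Fin N) :=
    LinearIsometry.toLinearIsometryEquiv ⟨planeRotation i k s, norm_planeRotation hik s⟩ rfl
  exact (toSphere_measurePreserving volume e e.measurePreserving _ fun v => rfl).smul_measure _

theorem continuous_sphereRotation {N : ℕ} {i k : Fin N} (hik : i ≠ k) :
    Continuous fun p : ℝ × (𝕊 N) => sphereRotation hik p.1 p.2 := by
  refine Continuous.subtype_mk (PiLp.continuous_toLp 2 _ |>.comp (continuous_pi fun m => ?_)) _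
  dsimp only
  split_ifs <;> fun_prop

theorem Continuous.intervalIntegral_integral_swap {X : Type*} [TopologicalSpace X] [CompactSpace X]
    [SecondCountableTopology X] [MeasurableSpace X] [BorelSpace X] (μ : Measure X)
    [IsFiniteMeasure μ] {H : ℝ → X → ℝ} (hH : Continuous (Function.uncurry H)) (a b : ℝ) :
    ∫ s in a..b, (∫ v, H s v ∂μ) = ∫ v, (∫ s in a..b, H s v) ∂μ := by
  have key : ∀ a b : ℝ, ∫ s in Ioc a b, (∫ v, H s v ∂μ) = ∫ v, (∫ s in Ioc a b, H s v) ∂μ := by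
    intro a b
    refine integral_integral_swap ?_
    obtain ⟨C, hC⟩ := (isCompact_Icc.prod isCompact_univ).exists_bound_of_continuousOn
      (s := Icc a b ×ˢ (univ : Set X)) hH.continuousOn
    refine Integrable.mono' (g := fun _ => C) (integrable_const C) hH.aestronglyMeasurable ?_
    have : ∀ᵐ p : ℝ × X ∂((volume.restrict (Ioc a b)).prod μ), p.1 ∈ Ioc a b :=
      Measure.quasiMeasurePreserving_fst.ae (ae_restrict_mem measurableSet_Ioc)
    filter_upwards [this] with p hp
    exact hC p ⟨Ioc_subset_Icc_self hp, mem_univ _⟩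
  have hint : ∀ a b : ℝ, Integrable (fun v => ∫ s in Ioc a b, H s v) μ := by
    intro a b
    obtain ⟨C, hC⟩ := (isCompact_Icc.prod isCompact_univ).exists_bound_of_continuousOn
      (s := Icc a b ×ˢ (univ : Set X)) hH.continuousOn
    refine Integrable.mono' (g := fun _ => C * volume.real (Ioc a b)) (integrable_const _)
      ?_ (Eventually.of_forall fun v => ?_)
    · exact (StronglyMeasurable.integral_prod_right'
        (f := fun p : X × ℝ => H p.2 p.1) (by
          exact (hH.comp continuous_swap).stronglyMeasurable)).aestronglyMeasurable
    · exact norm_setIntegral_le_of_norm_le_const measure_Ioc_lt_top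
        fun s hs => hC (s, v) ⟨Ioc_subset_Icc_self hs, mem_univ _⟩
  simp only [intervalIntegral]
  rw [key, key, integral_sub (hint _ _) (hint _ _)]

theorem two_pi_mul_integral_eq {N : ℕ} (hN : 2 ≤ N) {i k : Fin N} (hik : i ≠ k) {h : (𝕊 N) → ℝ}
    (hc : Continuous h) : 2 * Real.pi * ∫ v, h v ∂(sphereUniform N) =
      ∫ v, (∫ s in (0 : ℝ)..2 * Real.pi, h (sphereRotation hik s v)) ∂(sphereUniform N) := by
  have := sphereUniform_isProbabilityMeasure hN
  rw [← Continuous.intervalIntegral_integral_swap (sphereUniform N)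
    (H := fun s v => h (sphereRotation hik s v)) (hc.comp (continuous_sphereRotation hik))]
  have : ∀ s : ℝ, ∫ v, h (sphereRotation hik s v) ∂(sphereUniform N) =
      ∫ v, h v ∂(sphereUniform N) := by
    intro s
    have hp := measurePreserving_sphereRotation hik s
    conv_rhs => rw [← hp.map_eq]
    exact (integral_map hp.measurable.aemeasurable hc.aestronglyMeasurable).symm
  simp [this]

/-! ### Monotonicity along the heat flow -/

theorem integral_sqrt_mul_sqrt_mul_nonneg {p p' p'' q q' q'' : ℝ → ℝ} {a b : ℝ} (hab : a ≤ b)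
    (hp : ∀ s, HasDerivAt p (p' s) s) (hp' : ∀ s, HasDerivAt p' (p'' s) s)
    (hq : ∀ s, HasDerivAt q (q' s) s) (hq' : ∀ s, HasDerivAt q' (q'' s) s)
    (hpc : Continuous p'') (hqc : Continuous q'') (hp0 : ∀ s, 0 < p s) (hq0 : ∀ s, 0 < q s)
    (hpab : p b = p a) (hpab' : p' b = p' a) (hqab : q b = q a) (hqab' : q' b = q' a) :
    0 ≤ ∫ s in a..b, √(p s) * √(q s) * (p'' s / p s + q'' s / q s) := by
  have cp : Continuous p := continuous_iff_continuousAt.2 fun s => (hp s).continuousAt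
  have cq : Continuous q := continuous_iff_continuousAt.2 fun s => (hq s).continuousAt
  have cp' : Continuous p' := continuous_iff_continuousAt.2 fun s => (hp' s).continuousAt
  have cq' : Continuous q' := continuous_iff_continuousAt.2 fun s => (hq' s).continuousAt
  have np : ∀ s, p s ≠ 0 := fun s => (hp0 s).ne'
  have nq : ∀ s, q s ≠ 0 := fun s => (hq0 s).ne'
  let G' : ℝ → ℝ := fun s => √(p s) * √(q s) * (p'' s / p s + q'' s / q s +
    ((p' s / p s + q' s / q s) ^ 2 / 2 - (p' s / p s) ^ 2 - (q' s / q s) ^ 2))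
  have hG : ∀ s, HasDerivAt (fun s => √(p s) * √(q s) * (p' s / p s + q' s / q s)) (G' s) s := by
    intro s
    have h := (((hp s).sqrt (np s)).mul ((hq s).sqrt (nq s))).mul
      (((hp' s).div (hp s) (np s)).add ((hq' s).div (hq s) (nq s)))
    refine h.congr_deriv ?_
    have e1 : √(p s) ^ 2 = p s := Real.sq_sqrt (hp0 s).le
    have e2 : √(q s) ^ 2 = q s := Real.sq_sqrt (hq0 s).le
    have n1 : √(p s) ≠ 0 := (Real.sqrt_pos.2 (hp0 s)).ne'
    have n2 : √(q s) ≠ 0 := (Real.sqrt_pos.2 (hq0 s)).ne'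
    simp only [G', Pi.mul_apply, Pi.add_apply, Pi.div_apply]
    generalize √(p s) = x at *
    generalize √(q s) = y at *
    rw [← e1, ← e2]
    field_simp
    ring
  have cG' : Continuous G' := by
    have c1 := hpc.div cp np
    have c2 := hqc.div cq nq
    have c3 := cp'.div cp np
    have c4 := cq'.div cq nq
    exact (cp.sqrt.mul cq.sqrt).mul ((c1.add c2).add
      (((((c3.add c4).pow 2).div_const 2).sub (c3.pow 2)).sub (c4.pow 2)))
  have h0 : ∫ s in a..b, G' s = 0 := by
    rw [intervalIntegral.integral_eq_sub_of_hasDerivAt (fun s _ => hG s)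
      (cG'.intervalIntegrable _ _), hpab, hpab', hqab, hqab', sub_self]
  rw [← h0]
  refine intervalIntegral.integral_mono_on hab (cG'.intervalIntegrable _ _)
    (Continuous.intervalIntegrable ?_ _ _) fun s _ => ?_
  · exact (cp.sqrt.mul cq.sqrt).mul ((hpc.div cp np).add (hqc.div cq nq))
  · refine mul_le_mul_of_nonneg_left ?_ (by positivity)
    nlinarith [sq_nonneg (p' s / p s - q' s / q s)]

/-- The Laplacian of the sphere `S^{N-1}` on functions of a single coordinate. -/
noncomputable def zonalLaplacian (N : ℕ) : ℝ[X] →ₗ[ℝ] ℝ[X] where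
  toFun g := (1 - X ^ 2) * derivative (derivative g) - C ((N : ℝ) - 1) * (X * derivative g)
  map_add' f g := by simp only [map_add]; ring
  map_smul' c g := by
    simp only [derivative_smul, RingHom.id_apply]
    simp only [smul_eq_C_mul]
    ring

theorem eval_zonalLaplacian (N : ℕ) (g : ℝ[X]) (x : ℝ) :
    (zonalLaplacian N g).eval x = (1 - x ^ 2) * g.derivative.derivative.eval x -
      ((N : ℝ) - 1) * (x * g.derivative.eval x) := by
  simp [zonalLaplacian]

/-- The second derivative along rotations in the plane of the coordinates `i` and `k` of the
function `g (v k)`. -/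
noncomputable def rotationLaplacian {N : ℕ} (g : ℝ[X]) (k i : Fin N) (v : 𝕊 N) : ℝ :=
  v.1 i ^ 2 * g.derivative.derivative.eval (v.1 k) - v.1 k * g.derivative.eval (v.1 k)

theorem coord_mem_Icc {N : ℕ} (v : 𝕊 N) (j : Fin N) : v.1 j ∈ Icc (-1 : ℝ) 1 := by
  rw [mem_Icc, ← abs_le, ← Real.norm_eq_abs]
  refine (PiLp.norm_apply_le v.1 j).trans ?_
  simp

theorem sum_sq_coord {N : ℕ} (v : 𝕊 N) : ∑ i, v.1 i ^ 2 = 1 := by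
  have h : ‖v.1‖ = 1 := by simp
  rw [EuclideanSpace.norm_eq, Real.sqrt_eq_one] at h
  simpa using h

theorem sum_rotationLaplacian {N : ℕ} (g : ℝ[X]) (k : Fin N) (v : 𝕊 N) :
    ∑ i ∈ Finset.univ.erase k, rotationLaplacian g k i v =
      (zonalLaplacian N g).eval (v.1 k) := by
  have h := sum_sq_coord v
  rw [← Finset.add_sum_erase _ _ (Finset.mem_univ k)] at h
  have hN : 1 ≤ N := Fin.pos k
  simp only [rotationLaplacian, Finset.sum_sub_distrib, ← Finset.sum_mul, Finset.sum_const,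
    Finset.card_erase_of_mem (Finset.mem_univ k), Finset.card_univ, Fintype.card_fin,
    nsmul_eq_mul, eval_zonalLaplacian]
  push_cast [Nat.cast_sub hN]
  linear_combination h * g.derivative.derivative.eval (v.1 k)

theorem continuous_coord {N : ℕ} (j : Fin N) : Continuous fun v : 𝕊 N => v.1 j := by
  fun_prop

theorem continuous_eval_coord {N : ℕ} (g : ℝ[X]) (j : Fin N) :
    Continuous fun v : 𝕊 N => g.eval (v.1 j) :=
  g.continuous.comp (continuous_coord j)

theorem continuous_rotationLaplacian {N : ℕ} (g : ℝ[X]) (k i : Fin N) :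
    Continuous (rotationLaplacian g k i) :=
  (((continuous_coord i).pow 2).mul (continuous_eval_coord _ k)).sub
    ((continuous_coord k).mul (continuous_eval_coord _ k))

section Rotation

variable {N : ℕ} {i k : Fin N} (hik : i ≠ k) (v : 𝕊 N)

theorem sphereRotation_apply_right (s : ℝ) :
    (sphereRotation hik s v).1 k = Real.cos s * v.1 k + Real.sin s * v.1 i := by
  simp [coe_sphereRotation, planeRotation_apply]

theorem sphereRotation_apply_left (s : ℝ) :
    (sphereRotation hik s v).1 i = Real.cos s * v.1 i - Real.sin s * v.1 k := by
  simp [coe_sphereRotation, planeRotation_apply, hik]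

theorem sphereRotation_apply_of_ne (s : ℝ) {m : Fin N} (hi : m ≠ i) (hk : m ≠ k) :
    (sphereRotation hik s v).1 m = v.1 m := by
  simp [coe_sphereRotation, planeRotation_apply, hi, hk]

theorem sphereRotation_zero_apply_right : (sphereRotation hik 0 v).1 k = v.1 k := by
  simp [sphereRotation_apply_right]

theorem sphereRotation_zero_apply_left : (sphereRotation hik 0 v).1 i = v.1 i := by
  simp [sphereRotation_apply_left]

theorem sphereRotation_two_pi_apply_right :
    (sphereRotation hik (2 * Real.pi) v).1 k = v.1 k := by
  simp [sphereRotation_apply_right]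

theorem sphereRotation_two_pi_apply_left :
    (sphereRotation hik (2 * Real.pi) v).1 i = v.1 i := by
  simp [sphereRotation_apply_left]

theorem hasDerivAt_sphereRotation_right (s : ℝ) :
    HasDerivAt (fun s => (sphereRotation hik s v).1 k) ((sphereRotation hik s v).1 i) s := by
  simp only [sphereRotation_apply_right, sphereRotation_apply_left]
  exact (((Real.hasDerivAt_cos s).mul_const _).add
    ((Real.hasDerivAt_sin s).mul_const _)).congr_deriv (by ring)

theorem hasDerivAt_sphereRotation_left (s : ℝ) :
    HasDerivAt (fun s => (sphereRotation hik s v).1 i) (-(sphereRotation hik s v).1 k) s := by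
  simp only [sphereRotation_apply_right, sphereRotation_apply_left]
  exact (((Real.hasDerivAt_cos s).mul_const _).sub
    ((Real.hasDerivAt_sin s).mul_const _)).congr_deriv (by ring)

theorem hasDerivAt_eval_sphereRotation_right (g : ℝ[X]) (s : ℝ) :
    HasDerivAt (fun s => g.eval ((sphereRotation hik s v).1 k))
      (g.derivative.eval ((sphereRotation hik s v).1 k) * (sphereRotation hik s v).1 i) s :=
  (g.hasDerivAt _).comp s (hasDerivAt_sphereRotation_right hik v s)

theorem hasDerivAt_eval_sphereRotation_left (g : ℝ[X]) (s : ℝ) :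
    HasDerivAt (fun s => g.eval ((sphereRotation hik s v).1 i))
      (g.derivative.eval ((sphereRotation hik s v).1 i) * -(sphereRotation hik s v).1 k) s :=
  (g.hasDerivAt _).comp s (hasDerivAt_sphereRotation_left hik v s)

theorem hasDerivAt_deriv_sphereRotation_right (g : ℝ[X]) (s : ℝ) :
    HasDerivAt
      (fun s => g.derivative.eval ((sphereRotation hik s v).1 k) * (sphereRotation hik s v).1 i)
      (rotationLaplacian g k i (sphereRotation hik s v)) s :=
  ((hasDerivAt_eval_sphereRotation_right hik v g.derivative s).mul
    (hasDerivAt_sphereRotation_left hik v s)).congr_deriv (by rw [rotationLaplacian]; ring)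

theorem hasDerivAt_deriv_sphereRotation_left (g : ℝ[X]) (s : ℝ) :
    HasDerivAt
      (fun s => g.derivative.eval ((sphereRotation hik s v).1 i) * -(sphereRotation hik s v).1 k)
      (rotationLaplacian g i k (sphereRotation hik s v)) s :=
  ((hasDerivAt_eval_sphereRotation_left hik v g.derivative s).mul
    (hasDerivAt_sphereRotation_right hik v s).neg).congr_deriv (by
      rw [rotationLaplacian, Pi.neg_apply]; ring)

theorem continuous_rotationLaplacian_sphereRotation (g : ℝ[X]) (m n : Fin N) :
    Continuous fun s => rotationLaplacian g m n (sphereRotation hik s v) := by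
  have h : Continuous fun s => sphereRotation hik s v :=
    Continuous.comp (f := fun s : ℝ => (s, v)) (continuous_sphereRotation hik)
      (Continuous.prodMk_left v)
  exact (continuous_rotationLaplacian g m n).comp h

theorem prod_sphereRotation (φ : Fin N → ℝ → ℝ) (s : ℝ) :
    ∏ j, φ j ((sphereRotation hik s v).1 j) =
      (∏ j ∈ (Finset.univ.erase k).erase i, φ j (v.1 j)) *
      (φ k ((sphereRotation hik s v).1 k) * φ i ((sphereRotation hik s v).1 i)) := by
  rw [← Finset.mul_prod_erase _ _ (Finset.mem_univ k),
    ← Finset.mul_prod_erase (Finset.univ.erase k) _ (a := i) (by simp [hik]),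
    Finset.prod_congr rfl (g := fun j => φ j (v.1 j))]
  · ring
  · intro m hm
    simp only [Finset.mem_erase] at hm
    rw [sphereRotation_apply_of_ne hik v s hm.1 hm.2.1]

theorem integral_sphereRotation_pair_nonneg
    {u : Fin N → ℝ[X]} (hu : ∀ j, ∀ x ∈ Icc (-1 : ℝ) 1, 0 < (u j).eval x) :
    0 ≤ ∫ s in (0 : ℝ)..2 * Real.pi,
      √((u k).eval ((sphereRotation hik s v).1 k)) * √((u i).eval ((sphereRotation hik s v).1 i)) *
      (rotationLaplacian (u k) k i (sphereRotation hik s v) /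
          (u k).eval ((sphereRotation hik s v).1 k) +
        rotationLaplacian (u i) i k (sphereRotation hik s v) /
          (u i).eval ((sphereRotation hik s v).1 i)) :=
  integral_sqrt_mul_sqrt_mul_nonneg Real.two_pi_pos.le
    (hasDerivAt_eval_sphereRotation_right hik v (u k))
    (hasDerivAt_deriv_sphereRotation_right hik v (u k))
    (hasDerivAt_eval_sphereRotation_left hik v (u i))
    (hasDerivAt_deriv_sphereRotation_left hik v (u i))
    (continuous_rotationLaplacian_sphereRotation hik v _ _ _)
    (continuous_rotationLaplacian_sphereRotation hik v _ _ _)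
    (fun s => hu _ _ (coord_mem_Icc _ _)) (fun s => hu _ _ (coord_mem_Icc _ _))
    (by rw [sphereRotation_zero_apply_right, sphereRotation_two_pi_apply_right])
    (by rw [sphereRotation_zero_apply_right, sphereRotation_two_pi_apply_right,
      sphereRotation_zero_apply_left, sphereRotation_two_pi_apply_left])
    (by rw [sphereRotation_zero_apply_left, sphereRotation_two_pi_apply_left])
    (by rw [sphereRotation_zero_apply_right, sphereRotation_two_pi_apply_right,
      sphereRotation_zero_apply_left, sphereRotation_two_pi_apply_left])

end Rotation

theorem integral_pair_nonneg {N : ℕ} (hN : 2 ≤ N) {i k : Fin N} (hik : i ≠ k)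
    {u : Fin N → ℝ[X]} (hu : ∀ j, ∀ x ∈ Icc (-1 : ℝ) 1, 0 < (u j).eval x) :
    0 ≤ ∫ v : 𝕊 N, (∏ j, √((u j).eval (v.1 j))) *
      (rotationLaplacian (u k) k i v / (u k).eval (v.1 k) +
        rotationLaplacian (u i) i k v / (u i).eval (v.1 i)) ∂(sphereUniform N) := by
  have hu0 : ∀ j (v : 𝕊 N), (u j).eval (v.1 j) ≠ 0 := fun j v => (hu j _ (coord_mem_Icc v j)).ne'
  refine nonneg_of_mul_nonneg_right ?_ Real.two_pi_pos
  have hc : Continuous fun v : 𝕊 N => (∏ j, √((u j).eval (v.1 j))) *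
      (rotationLaplacian (u k) k i v / (u k).eval (v.1 k) +
        rotationLaplacian (u i) i k v / (u i).eval (v.1 i)) :=
    (continuous_finsetProd _ fun j _ => (continuous_eval_coord _ j).sqrt).mul
      (((continuous_rotationLaplacian _ _ _).div (continuous_eval_coord _ _) (hu0 k)).add
        ((continuous_rotationLaplacian _ _ _).div (continuous_eval_coord _ _) (hu0 i)))
  rw [two_pi_mul_integral_eq hN hik hc]
  refine integral_nonneg fun v => ?_
  simp only [Pi.zero_apply, prod_sphereRotation hik v (fun j x => √((u j).eval x))]
  simp_rw [mul_assoc (∏ j ∈ (Finset.univ.erase k).erase i, _)]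
  rw [intervalIntegral.integral_const_mul]
  exact mul_nonneg (Finset.prod_nonneg fun _ _ => Real.sqrt_nonneg _)
    (integral_sphereRotation_pair_nonneg hik v hu)

theorem integral_prod_sqrt_mul_sum_zonalLaplacian_nonneg {N : ℕ} (hN : 2 ≤ N)
    {u : Fin N → ℝ[X]} (hu : ∀ j, ∀ x ∈ Icc (-1 : ℝ) 1, 0 < (u j).eval x) :
    0 ≤ ∫ v : 𝕊 N, (∏ j, √((u j).eval (v.1 j))) *
      ∑ j, (zonalLaplacian N (u j)).eval (v.1 j) / (u j).eval (v.1 j) ∂(sphereUniform N) := by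
  have := sphereUniform_isProbabilityMeasure hN
  have hu0 : ∀ j (v : 𝕊 N), (u j).eval (v.1 j) ≠ 0 := fun j v => (hu j _ (coord_mem_Icc v j)).ne'
  let T : Fin N → Fin N → (𝕊 N) → ℝ := fun k i v =>
    if i = k then 0 else (∏ j, √((u j).eval (v.1 j))) *
      (rotationLaplacian (u k) k i v / (u k).eval (v.1 k))
  have hT : ∀ k i, Integrable (T k i) (sphereUniform N) := by
    intro k i
    refine Continuous.integrable_of_hasCompactSupport ?_ (HasCompactSupport.of_compactSpace _)
    by_cases h : i = k
    · simp only [T, if_pos h]; exact continuous_const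
    · simp only [T, if_neg h]
      exact (continuous_finsetProd _ fun j _ => (continuous_eval_coord _ j).sqrt).mul
        ((continuous_rotationLaplacian _ _ _).div (continuous_eval_coord _ _) (hu0 k))
  have hsum : ∀ v : 𝕊 N, (∏ j, √((u j).eval (v.1 j))) *
      ∑ j, (zonalLaplacian N (u j)).eval (v.1 j) / (u j).eval (v.1 j) = ∑ k, ∑ i, T k i v := by
    intro v
    rw [Finset.mul_sum]
    refine Finset.sum_congr rfl fun k _ => ?_
    rw [← sum_rotationLaplacian, Finset.sum_div, Finset.mul_sum,
      ← Finset.add_sum_erase _ _ (Finset.mem_univ k)]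
    simp only [T, if_true, zero_add]
    exact Finset.sum_congr rfl fun i hi => by rw [if_neg (Finset.ne_of_mem_erase hi)]
  have hpair : ∀ k i, 0 ≤ (∫ v, T k i v ∂(sphereUniform N)) + ∫ v, T i k v ∂(sphereUniform N) := by
    intro k i
    rw [← integral_add (hT k i) (hT i k)]
    by_cases h : i = k
    · simp [T, h]
    · have hp := integral_pair_nonneg hN h hu
      simpa only [T, if_neg h, if_neg (Ne.symm h), mul_add] using hp
  simp_rw [hsum]
  rw [integral_finsetSum _ fun k _ => integrable_finsetSum _ fun i _ => hT k i]
  simp_rw [integral_finsetSum _ fun i _ => hT _ i]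
  have h2 : 0 ≤ ∑ k, ∑ i, ((∫ v, T k i v ∂(sphereUniform N)) + ∫ v, T i k v ∂(sphereUniform N)) :=
    Finset.sum_nonneg fun k _ => Finset.sum_nonneg fun i _ => hpair k i
  simp only [Finset.sum_add_distrib] at h2
  rw [Finset.sum_comm (f := fun k i => ∫ v, T i k v ∂(sphereUniform N))] at h2
  linarith

theorem integral_zonalLaplacian {N : ℕ} (hN : 2 ≤ N) (g : ℝ[X]) (k : Fin N) :
    ∫ v : 𝕊 N, (zonalLaplacian N g).eval (v.1 k) ∂(sphereUniform N) = 0 := by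
  have := sphereUniform_isProbabilityMeasure hN
  simp_rw [← sum_rotationLaplacian]
  rw [integral_finsetSum _ fun i _ => (continuous_rotationLaplacian g k i
    ).integrable_of_hasCompactSupport (HasCompactSupport.of_compactSpace _)]
  refine Finset.sum_eq_zero fun i hi => ?_
  have hik := Finset.ne_of_mem_erase hi
  have hpi : (2 * Real.pi) ≠ 0 := by positivity
  refine (mul_eq_zero_iff_left hpi).1 ?_
  rw [two_pi_mul_integral_eq hN hik (continuous_rotationLaplacian _ _ _)]
  refine integral_eq_zero_of_ae (Eventually.of_forall fun v => ?_)
  dsimp only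
  rw [intervalIntegral.integral_eq_sub_of_hasDerivAt
    (fun s _ => hasDerivAt_deriv_sphereRotation_right hik v g s)
    ((continuous_rotationLaplacian_sphereRotation hik v _ _ _).intervalIntegrable _ _),
    sphereRotation_zero_apply_right, sphereRotation_two_pi_apply_right,
    sphereRotation_zero_apply_left, sphereRotation_two_pi_apply_left, sub_self, Pi.zero_apply]

/-! ### The heat flow on functions of one coordinate -/

/-- The `k`-th eigenvalue of minus the Laplacian of the sphere `S^{N-1}`, for `2 ≤ N`. -/
def zonalEigenvalue (N k : ℕ) : ℕ := k * (k + (N - 2))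

theorem zonalEigenvalue_pos (N : ℕ) {k : ℕ} (hk : k ≠ 0) : 0 < zonalEigenvalue N k :=
  Nat.mul_pos (by omega) (by omega)

theorem zonalEigenvalue_strictMono (N : ℕ) : StrictMono (zonalEigenvalue N) := by
  intro a b hab
  exact Nat.mul_lt_mul'' hab (by omega)

theorem coeff_zonalLaplacian {N : ℕ} (hN : 2 ≤ N) (g : ℝ[X]) (n : ℕ) :
    (zonalLaplacian N g).coeff n =
      (n + 2) * (n + 1) * g.coeff (n + 2) - zonalEigenvalue N n * g.coeff n := by
  have h : zonalLaplacian N g = derivative (derivative g) - X ^ 2 * derivative (derivative g) -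
      C ((N : ℝ) - 1) * (X * derivative g) := by
    simp only [zonalLaplacian, LinearMap.coe_mk, AddHom.coe_mk]
    ring
  rw [h, zonalEigenvalue, coeff_sub, coeff_sub, coeff_C_mul]
  push_cast [Nat.cast_sub hN]
  rcases n with _ | _ | n
  · simp [coeff_derivative]
    ring
  · simp [coeff_X_pow_mul', coeff_derivative, coeff_X_mul]
    ring
  · simp [coeff_X_pow_mul', coeff_derivative, coeff_X_mul]
    ring

theorem natDegree_zonalLaplacian_add_le {N : ℕ} (hN : 2 ≤ N) {g : ℝ[X]} {d : ℕ}
    (hg : g.natDegree ≤ d + 1) :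
    (zonalLaplacian N g + (zonalEigenvalue N (d + 1) : ℝ) • g).natDegree ≤ d := by
  rw [natDegree_le_iff_coeff_eq_zero]
  intro n hn
  rw [coeff_add, coeff_smul, coeff_zonalLaplacian hN, smul_eq_mul,
    coeff_eq_zero_of_natDegree_lt (n := n + 2) (by omega)]
  rcases eq_or_ne n (d + 1) with rfl | h
  · ring
  · rw [coeff_eq_zero_of_natDegree_lt (n := n) (by omega)]
    ring

theorem exists_sum_eigenfunctions {N : ℕ} (hN : 2 ≤ N) (d : ℕ) :
    ∀ g : ℝ[X], g.natDegree ≤ d → ∃ q : ℕ → ℝ[X], (∃ c, q 0 = C c) ∧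
      (∀ k, zonalLaplacian N (q k) = -(zonalEigenvalue N k : ℝ) • q k) ∧
      g = ∑ k ∈ Finset.range (d + 1), q k := by
  induction d with
  | zero =>
    intro g hg
    rw [Nat.le_zero, natDegree_eq_zero] at hg
    obtain ⟨c, rfl⟩ := hg
    refine ⟨fun k => if k = 0 then C c else 0, ⟨c, by simp⟩, fun k => ?_, by simp⟩
    rcases eq_or_ne k 0 with rfl | hk
    · simp [zonalLaplacian, zonalEigenvalue]
    · simp [hk]
  | succ d ih =>
    intro g hg
    obtain ⟨ρ, ⟨c, hc⟩, hρ, hsum⟩ := ih _ (natDegree_zonalLaplacian_add_le hN hg)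
    let lam : ℕ → ℝ := fun k => zonalEigenvalue N k
    let r : ℕ → ℝ[X] := fun k => (lam (d + 1) - lam k)⁻¹ • ρ k
    have hr : ∀ k, zonalLaplacian N (r k) = -lam k • r k := by
      intro k
      simp only [r, map_smul, hρ]
      rw [smul_comm]
    refine ⟨Function.update r (d + 1) (g - ∑ k ∈ Finset.range (d + 1), r k),
      ⟨(lam (d + 1) - lam 0)⁻¹ * c, ?_⟩, fun k => ?_, ?_⟩
    · rw [Function.update_of_ne (by omega)]
      simp only [r, hc, smul_C, smul_eq_mul]
    · rcases eq_or_ne k (d + 1) with rfl | hk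
      · rw [Function.update_self, map_sub, map_sum, eq_sub_of_add_eq hsum]
        have hk : ∀ k ∈ Finset.range (d + 1),
            zonalLaplacian N (r k) = ρ k - lam (d + 1) • r k := by
          intro k hk
          have hne : lam (d + 1) - lam k ≠ 0 := by
            have := zonalEigenvalue_strictMono N (Finset.mem_range.1 hk)
            have : lam k < lam (d + 1) := Nat.cast_lt.2 this
            linarith
          have : ρ k = (lam (d + 1) - lam k) • r k := by
            simp only [r]
            rw [smul_inv_smul₀ hne]
          rw [hr, this]
          module
        rw [Finset.sum_congr rfl hk, Finset.sum_sub_distrib, ← Finset.smul_sum]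
        module
      · rw [Function.update_of_ne hk]
        exact hr k
    · rw [Finset.sum_range_succ, Function.update_self, Finset.sum_congr rfl (g := r)]
      · abel
      · intro k hk
        rw [Function.update_of_ne (Finset.mem_range.1 hk).ne]

/-- The heat flow at time `-log s` of the sum of the eigenfunctions `q 0, …, q d`. -/
noncomputable def zonalFlow (N d : ℕ) (q : ℕ → ℝ[X]) (s : ℝ) : ℝ[X] :=
  ∑ k ∈ Finset.range (d + 1), s ^ zonalEigenvalue N k • q k

/-- The derivative of `zonalFlow`. -/
noncomputable def zonalFlowDeriv (N d : ℕ) (q : ℕ → ℝ[X]) (s : ℝ) : ℝ[X] :=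
  ∑ k ∈ Finset.range (d + 1), (zonalEigenvalue N k * s ^ (zonalEigenvalue N k - 1)) • q k

theorem hasDerivAt_eval_zonalFlow (N d : ℕ) (q : ℕ → ℝ[X]) (s x : ℝ) :
    HasDerivAt (fun s => (zonalFlow N d q s).eval x) ((zonalFlowDeriv N d q s).eval x) s := by
  simp only [zonalFlow, zonalFlowDeriv, eval_finsetSum, eval_smul, smul_eq_mul]
  exact HasDerivAt.fun_sum fun k _ => (hasDerivAt_pow _ s).mul_const _

theorem continuous_eval_zonalFlow (N d : ℕ) (q : ℕ → ℝ[X]) :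
    Continuous fun p : ℝ × ℝ => (zonalFlow N d q p.1).eval p.2 := by
  simp only [zonalFlow, eval_finsetSum, eval_smul, smul_eq_mul]
  exact continuous_finsetSum _ fun k _ =>
    (continuous_fst.pow _).mul ((q k).continuous.comp continuous_snd)

theorem continuous_eval_zonalFlowDeriv (N d : ℕ) (q : ℕ → ℝ[X]) :
    Continuous fun p : ℝ × ℝ => (zonalFlowDeriv N d q p.1).eval p.2 := by
  simp only [zonalFlowDeriv, eval_finsetSum, eval_smul, smul_eq_mul]
  exact continuous_finsetSum _ fun k _ =>
    (continuous_const.mul (continuous_fst.pow _)).mul ((q k).continuous.comp continuous_snd)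

theorem smul_zonalFlowDeriv {N : ℕ} {q : ℕ → ℝ[X]}
    (hq : ∀ k, zonalLaplacian N (q k) = -(zonalEigenvalue N k : ℝ) • q k) (d : ℕ) (s : ℝ) :
    s • zonalFlowDeriv N d q s = -zonalLaplacian N (zonalFlow N d q s) := by
  rw [zonalFlow, zonalFlowDeriv, map_sum, ← Finset.sum_neg_distrib, Finset.smul_sum]
  refine Finset.sum_congr rfl fun k _ => ?_
  rw [map_smul, hq, smul_smul, smul_smul, ← neg_smul]
  congr 1
  rcases Nat.eq_zero_or_pos (zonalEigenvalue N k) with h | h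
  · simp [h]
  · obtain ⟨m, hm⟩ := Nat.exists_eq_succ_of_ne_zero h.ne'
    rw [hm, Nat.succ_sub_one, pow_succ]
    ring

theorem zonalFlow_one (N d : ℕ) (q : ℕ → ℝ[X]) :
    zonalFlow N d q 1 = ∑ k ∈ Finset.range (d + 1), q k := by
  simp [zonalFlow]

theorem zonalFlow_zero (N d : ℕ) (q : ℕ → ℝ[X]) : zonalFlow N d q 0 = q 0 := by
  rw [zonalFlow, Finset.sum_eq_single 0]
  · simp [zonalEigenvalue]
  · intro k _ hk
    rw [zero_pow (zonalEigenvalue_pos N hk).ne', zero_smul]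
  · simp

theorem nonneg_of_hasDerivAt_of_forall_ge {f : ℝ → ℝ} {f' a b : ℝ} (hab : a < b)
    (hf : HasDerivAt f f' a) (h : ∀ x ∈ Ioo a b, f a ≤ f x) : 0 ≤ f' := by
  have ht := (hasDerivWithinAt_iff_tendsto_slope' (s := Ioi a) (by simp)).1 hf.hasDerivWithinAt
  refine ge_of_tendsto ht ?_
  filter_upwards [Ioo_mem_nhdsGT hab] with x hx
  rw [slope_def_field]
  exact div_nonneg (sub_nonneg.2 (h x hx)) (sub_nonneg.2 hx.1.le)

theorem deriv_deriv_nonneg_of_isLocalMin {f : ℝ → ℝ} {x : ℝ} (hf : ContinuousAt f x)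
    (h : IsLocalMin f x) : 0 ≤ deriv (deriv f) x := by
  by_contra! hneg
  have hmax := isLocalMax_of_deriv_deriv_neg hneg h.deriv_eq_zero hf
  have heq : f =ᶠ[𝓝 x] fun _ => f x := by
    filter_upwards [h, hmax] with y h1 h2 using le_antisymm h2 h1
  have := heq.deriv.deriv_eq
  simp at this
  exact hneg.ne this

theorem eval_zonalLaplacian_nonneg_of_isMin {N : ℕ} (hN : 1 ≤ N) {g : ℝ[X]} {x : ℝ}
    (hx : x ∈ Icc (-1 : ℝ) 1) (hmin : ∀ y ∈ Icc (-1 : ℝ) 1, g.eval x ≤ g.eval y) :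
    0 ≤ (zonalLaplacian N g).eval x := by
  have hN' : (1 : ℝ) ≤ N := by exact_mod_cast hN
  have hcos : Real.cos (Real.arccos x) = x := Real.cos_arccos hx.1 hx.2
  have h1 : ∀ θ, HasDerivAt (fun θ => g.eval (Real.cos θ))
      (g.derivative.eval (Real.cos θ) * -Real.sin θ) θ :=
    fun θ => (g.hasDerivAt _).comp θ (Real.hasDerivAt_cos θ)
  have h2 : ∀ θ, HasDerivAt (fun θ => g.derivative.eval (Real.cos θ) * -Real.sin θ)
      (g.derivative.derivative.eval (Real.cos θ) * -Real.sin θ * -Real.sin θ +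
        g.derivative.eval (Real.cos θ) * -Real.cos θ) θ :=
    fun θ => ((g.derivative.hasDerivAt _).comp θ (Real.hasDerivAt_cos θ)).mul
      (Real.hasDerivAt_sin θ).neg
  have hloc : IsLocalMin (fun θ => g.eval (Real.cos θ)) (Real.arccos x) :=
    Eventually.of_forall fun θ => by
      simpa only [hcos] using hmin _ (Real.cos_mem_Icc θ)
  have hd1 := hloc.hasDerivAt_eq_zero (h1 _)
  have hd2 := deriv_deriv_nonneg_of_isLocalMin (h1 _).continuousAt hloc
  rw [funext fun θ => (h1 θ).deriv, (h2 _).deriv, hcos] at hd2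
  rw [hcos] at hd1
  have hsin := Real.sin_sq_add_cos_sq (Real.arccos x)
  rw [hcos] at hsin
  rw [eval_zonalLaplacian]
  rcases mul_eq_zero.1 hd1 with h | h
  · rw [h] at hd2 ⊢
    rw [show 1 - x ^ 2 = Real.sin (Real.arccos x) ^ 2 by linarith]
    linarith
  · rw [show 1 - x ^ 2 = Real.sin (Real.arccos x) ^ 2 by linarith]
    rw [neg_eq_zero] at h
    rw [h] at hd2 ⊢
    nlinarith

theorem le_eval_zonalFlow {N d : ℕ} (hN : 1 ≤ N) {q : ℕ → ℝ[X]}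
    (hq : ∀ k, zonalLaplacian N (q k) = -(zonalEigenvalue N k : ℝ) • q k) {m : ℝ}
    (hm : ∀ x ∈ Icc (-1 : ℝ) 1, m ≤ (zonalFlow N d q 1).eval x) {s x : ℝ}
    (hs : s ∈ Ioc (0 : ℝ) 1) (hx : x ∈ Icc (-1 : ℝ) 1) : m ≤ (zonalFlow N d q s).eval x := by
  refine le_of_forall_sub_le fun δ hδ => ?_
  obtain ⟨⟨s₀, x₀⟩, ⟨hs₀, hx₀⟩, hmin⟩ :=
    (isCompact_Icc.prod isCompact_Icc).exists_isMinOn (s := Icc s 1 ×ˢ Icc (-1 : ℝ) 1)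
      ⟨(s, x), ⟨le_rfl, hs.2⟩, hx⟩
      (f := fun p => (zonalFlow N d q p.1).eval p.2 - δ * p.1)
      ((continuous_eval_zonalFlow N d q).sub (continuous_const.mul continuous_fst)).continuousOn
  have hmin' : ∀ s' ∈ Icc s 1, ∀ y ∈ Icc (-1 : ℝ) 1,
      (zonalFlow N d q s₀).eval x₀ - δ * s₀ ≤ (zonalFlow N d q s').eval y - δ * s' :=
    fun s' hs' y hy => hmin (show (s', y) ∈ _ from ⟨hs', hy⟩)
  dsimp only at hs₀ hx₀
  have h0 : 0 < s₀ := hs.1.trans_le hs₀.1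
  rcases hs₀.2.eq_or_lt with h1 | h1
  · have e1 := hmin' s ⟨le_rfl, hs.2⟩ x hx
    have e2 := hm x₀ hx₀
    rw [h1] at e1
    nlinarith [mul_pos hδ hs.1]
  · exfalso
    have e1 := nonneg_of_hasDerivAt_of_forall_ge h1
      ((hasDerivAt_eval_zonalFlow N d q s₀ x₀).sub ((hasDerivAt_id s₀).const_mul δ))
      (fun y hy => hmin' y ⟨hs₀.1.trans hy.1.le, hy.2.le⟩ x₀ hx₀)
    have e2 := eval_zonalLaplacian_nonneg_of_isMin hN hx₀ (g := zonalFlow N d q s₀)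
      (fun y hy => by linarith [hmin' s₀ hs₀ y hy])
    have e3 := congrArg (eval x₀) (smul_zonalFlowDeriv hq d s₀)
    rw [eval_smul, eval_neg, smul_eq_mul] at e3
    nlinarith [mul_pos h0 hδ]

theorem eval_zonalFlow_pos {N d : ℕ} (hN : 1 ≤ N) {q : ℕ → ℝ[X]}
    (hq : ∀ k, zonalLaplacian N (q k) = -(zonalEigenvalue N k : ℝ) • q k)
    (hpos : ∀ x ∈ Icc (-1 : ℝ) 1, 0 < (zonalFlow N d q 1).eval x) {s x : ℝ}
    (hs : s ∈ Icc (0 : ℝ) 1) (hx : x ∈ Icc (-1 : ℝ) 1) : 0 < (zonalFlow N d q s).eval x := by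
  obtain ⟨y, hy, hmin⟩ := isCompact_Icc.exists_isMinOn (s := Icc (-1 : ℝ) 1) ⟨x, hx⟩
    (zonalFlow N d q 1).continuous.continuousOn
  refine (hpos y hy).trans_le ?_
  have key : ∀ s ∈ Ioc (0 : ℝ) 1, (zonalFlow N d q 1).eval y ≤ (zonalFlow N d q s).eval x :=
    fun s hs => le_eval_zonalFlow hN hq (fun z hz => hmin hz) hs hx
  rcases hs.1.eq_or_lt with rfl | h0
  · refine ge_of_tendsto (x := 𝓝[>] (0 : ℝ))
      ((hasDerivAt_eval_zonalFlow N d q 0 x).continuousAt.tendsto.mono_left nhdsWithin_le_nhds) ?_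
    filter_upwards [Ioo_mem_nhdsGT one_pos] with s hs using key s ⟨hs.1, hs.2.le⟩
  · exact key s ⟨h0, hs.2⟩

theorem integral_sum_eigenfunctions {N : ℕ} (hN : 2 ≤ N) {q : ℕ → ℝ[X]} {c : ℝ} (hc : q 0 = C c)
    (hq : ∀ k, zonalLaplacian N (q k) = -(zonalEigenvalue N k : ℝ) • q k) (d : ℕ) (j : Fin N) :
    ∫ v : 𝕊 N, (∑ k ∈ Finset.range (d + 1), q k).eval (v.1 j) ∂(sphereUniform N) = c := by
  have := sphereUniform_isProbabilityMeasure hN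
  simp only [eval_finsetSum]
  rw [integral_finsetSum _ fun k _ => (continuous_eval_coord (q k) j
    ).integrable_of_hasCompactSupport (HasCompactSupport.of_compactSpace _),
    Finset.sum_eq_single 0]
  · simp [hc]
  · intro k _ hk
    have h := integral_zonalLaplacian hN (q k) j
    simp only [hq, eval_smul, smul_eq_mul] at h
    rw [integral_const_mul] at h
    refine (mul_eq_zero_iff_left (neg_ne_zero.2 ?_)).1 h
    exact Nat.cast_ne_zero.2 (zonalEigenvalue_pos N hk).ne'
  · simp

/-! ### The inequality for positive polynomials -/

theorem HasDerivAt.prod_sqrt {ι : Type*} [Fintype ι] {p p' : ι → ℝ → ℝ} {s : ℝ}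
    (hp : ∀ j, HasDerivAt (p j) (p' j s) s) (h0 : ∀ j, 0 < p j s) :
    HasDerivAt (fun s => ∏ j, √(p j s)) ((∏ j, √(p j s)) * ∑ j, p' j s / p j s / 2) s := by
  classical
  refine (HasDerivAt.fun_finsetProd fun j _ => (hp j).sqrt (h0 j).ne').congr_deriv ?_
  rw [Finset.mul_sum]
  refine Finset.sum_congr rfl fun j hj => ?_
  rw [← Finset.mul_prod_erase _ _ hj, smul_eq_mul]
  have h := Real.sqrt_pos.2 (h0 j)
  have hsq := Real.sq_sqrt (h0 j).le
  have : p' j s / p j s = p' j s / √(p j s) ^ 2 := by rw [hsq]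
  rw [this]
  field_simp

theorem integral_prod_sqrt_zonalFlow_le {N : ℕ} (hN : 2 ≤ N) {d : Fin N → ℕ}
    {q : Fin N → ℕ → ℝ[X]}
    (hq : ∀ j k, zonalLaplacian N (q j k) = -(zonalEigenvalue N k : ℝ) • q j k)
    (hpos : ∀ j, ∀ x ∈ Icc (-1 : ℝ) 1, 0 < (zonalFlow N (d j) (q j) 1).eval x) :
    ∫ v : 𝕊 N, ∏ j, √((zonalFlow N (d j) (q j) 1).eval (v.1 j)) ∂(sphereUniform N) ≤
      ∫ v : 𝕊 N, ∏ j, √((zonalFlow N (d j) (q j) 0).eval (v.1 j)) ∂(sphereUniform N) := by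
  have := sphereUniform_isProbabilityMeasure hN
  let U : Fin N → ℝ → (𝕊 N) → ℝ := fun j s v => (zonalFlow N (d j) (q j) s).eval (v.1 j)
  let U' : Fin N → ℝ → (𝕊 N) → ℝ := fun j s v => (zonalFlowDeriv N (d j) (q j) s).eval (v.1 j)
  have hU : ∀ j v, ∀ s ∈ Icc (0 : ℝ) 1, 0 < U j s v := fun j v s hs =>
    eval_zonalFlow_pos (by omega) (hq j) (hpos j) hs (coord_mem_Icc v j)
  let τ : ℝ → ℝ := fun s => max 0 (min s 1)
  have hτ : ∀ s, τ s ∈ Icc (0 : ℝ) 1 := fun s =>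
    ⟨le_max_left _ _, max_le zero_le_one (min_le_right _ _)⟩
  have hτ' : ∀ s ∈ Icc (0 : ℝ) 1, τ s = s := fun s hs => by
    simp only [τ, min_eq_left hs.2, max_eq_right hs.1]
  let H : ℝ → (𝕊 N) → ℝ := fun s v =>
    (∏ j, √(U j (τ s) v)) * ∑ j, U' j (τ s) v / U j (τ s) v / 2
  have hτc : Continuous τ := continuous_const.max (continuous_id.min continuous_const)
  have hφ : ∀ j : Fin N, Continuous fun p : ℝ × (𝕊 N) => (τ p.1, p.2.1 j) := fun j =>
    (hτc.comp continuous_fst).prodMk ((continuous_coord j).comp continuous_snd)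
  have hUc : ∀ j, Continuous fun p : ℝ × (𝕊 N) => U j (τ p.1) p.2 := fun j =>
    (continuous_eval_zonalFlow N (d j) (q j)).comp (hφ j)
  have hU'c : ∀ j, Continuous fun p : ℝ × (𝕊 N) => U' j (τ p.1) p.2 := fun j =>
    (continuous_eval_zonalFlowDeriv N (d j) (q j)).comp (hφ j)
  have hH : Continuous (Function.uncurry H) :=
    (continuous_finsetProd _ fun j _ => (hUc j).sqrt).mul (continuous_finsetSum _ fun j _ =>
      ((hU'c j).div (hUc j) fun p => (hU j p.2 _ (hτ p.1)).ne').div_const 2)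
  have hint : ∀ v, ∫ s in (0 : ℝ)..1, H s v = ∏ j, √(U j 1 v) - ∏ j, √(U j 0 v) := by
    intro v
    refine intervalIntegral.integral_eq_sub_of_hasDerivAt (f := fun s => ∏ j, √(U j s v))
      (fun s hs => ?_) ?_
    · rw [uIcc_of_le zero_le_one] at hs
      simp only [H, hτ' s hs]
      exact HasDerivAt.prod_sqrt (p := fun j s => U j s v) (p' := fun j s => U' j s v)
        (fun j => hasDerivAt_eval_zonalFlow N (d j) (q j) s (v.1 j)) (fun j => hU j v s hs)
    · exact (hH.comp (Continuous.prodMk_left v)).intervalIntegrable _ _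
  have hle : ∀ s ∈ Ioc (0 : ℝ) 1, ∫ v, H s v ∂(sphereUniform N) ≤ 0 := by
    intro s hs
    have hs' : s ∈ Icc (0 : ℝ) 1 := ⟨hs.1.le, hs.2⟩
    have key := integral_prod_sqrt_mul_sum_zonalLaplacian_nonneg hN
      (u := fun j => zonalFlow N (d j) (q j) s)
      (fun j x hx => eval_zonalFlow_pos (by omega) (hq j) (hpos j) hs' hx)
    have hEq : ∀ v : 𝕊 N, H s v = -(2 * s)⁻¹ * ((∏ j, √(U j s v)) *
        ∑ j, (zonalLaplacian N (zonalFlow N (d j) (q j) s)).eval (v.1 j) / U j s v) := by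
      intro v
      simp only [H, hτ' s hs']
      rw [mul_left_comm, Finset.mul_sum _ _ (-(2 * s)⁻¹)]
      congr 1
      refine Finset.sum_congr rfl fun j _ => ?_
      have e := congrArg (eval (v.1 j)) (smul_zonalFlowDeriv (hq j) (d j) s)
      rw [eval_smul, eval_neg, smul_eq_mul] at e
      rw [← neg_eq_iff_eq_neg.2 e]
      have hs0 := hs.1.ne'
      simp only [U']
      field_simp
    simp_rw [hEq]
    rw [integral_const_mul]
    refine mul_nonpos_of_nonpos_of_nonneg ?_ key
    have := hs.1
    rw [neg_nonpos]
    positivity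
  have hcont : ∀ s ∈ Icc (0 : ℝ) 1, Integrable (fun v => ∏ j, √(U j s v)) (sphereUniform N) := by
    intro s _
    exact (continuous_finsetProd _ fun j _ => (continuous_eval_coord _ j).sqrt
      ).integrable_of_hasCompactSupport (HasCompactSupport.of_compactSpace _)
  rw [← sub_nonpos]
  change (∫ v, ∏ j, √(U j 1 v) ∂(sphereUniform N)) - ∫ v, ∏ j, √(U j 0 v) ∂(sphereUniform N) ≤ 0
  rw [← integral_sub (hcont 1 (by simp)) (hcont 0 (by simp))]
  simp_rw [← hint]
  rw [← Continuous.intervalIntegral_integral_swap _ hH, intervalIntegral.integral_of_le zero_le_one]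
  exact setIntegral_nonpos measurableSet_Ioc hle

theorem integral_prod_sqrt_eval_le {N : ℕ} (hN : 2 ≤ N) {g : Fin N → ℝ[X]}
    (hg : ∀ j, ∀ x ∈ Icc (-1 : ℝ) 1, 0 < (g j).eval x) :
    ∫ v : 𝕊 N, ∏ j, √((g j).eval (v.1 j)) ∂(sphereUniform N) ≤
      ∏ j, √(∫ v : 𝕊 N, (g j).eval (v.1 j) ∂(sphereUniform N)) := by
  have := sphereUniform_isProbabilityMeasure hN
  choose q hc hq hsum using fun j => exists_sum_eigenfunctions hN (g j).natDegree (g j) le_rfl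
  choose c hc using hc
  have h1 : ∀ j, zonalFlow N (g j).natDegree (q j) 1 = g j := fun j => by
    rw [zonalFlow_one]
    exact (hsum j).symm
  have h := integral_prod_sqrt_zonalFlow_le hN (d := fun j => (g j).natDegree) hq
    (by simpa only [h1] using hg)
  simp only [h1, zonalFlow_zero, hc, eval_C, integral_const, probReal_univ, one_smul] at h
  refine h.trans_eq (Finset.prod_congr rfl fun j _ => ?_)
  rw [← integral_sum_eigenfunctions hN (hc j) (hq j) (g j).natDegree j, ← hsum j]

/-! ### Approximation by positive polynomials -/

section Approximation

variable {ν : Measure ℝ} [IsProbabilityMeasure ν] {a b : ℝ} {g : ℝ → ℝ}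

theorem exists_pos_polynomial_integral_sub_le (hν : ∀ᵐ x ∂ν, x ∈ Icc a b) (hg : Integrable g ν)
    (hg0 : ∀ x, 0 ≤ g x) {ε : ℝ} (hε : 0 < ε) :
    ∃ P : ℝ[X], (∀ x ∈ Icc a b, 0 < P.eval x) ∧ Integrable (fun x => P.eval x) ν ∧
      ∫ x, ‖P.eval x - g x‖ ∂ν ≤ ε := by
  obtain ⟨h, hh, hhi⟩ := hg.exists_boundedContinuous_integral_sub_le (half_pos hε)
  obtain ⟨P, hP⟩ := exists_polynomial_near_of_continuousOn a b (fun x => max (h x) 0 + 2 * (ε / 6))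
    ((h.continuous.max continuous_const).add continuous_const).continuousOn (ε / 6) (by positivity)
  have hPi : Integrable (fun x => P.eval x) ν := by
    obtain ⟨C, hC⟩ := isCompact_Icc.exists_bound_of_continuousOn (s := Icc a b)
      P.continuous.continuousOn
    exact (integrable_const C).mono' P.continuous.aestronglyMeasurable (hν.mono hC)
  refine ⟨P, fun x hx => ?_, hPi, ?_⟩
  · have h1 := abs_lt.1 (hP x hx)
    have h2 := le_max_right (h x) 0
    linarith [h1.1]
  · calc ∫ x, ‖P.eval x - g x‖ ∂ν ≤ ∫ x, (ε / 2 + ‖g x - h x‖) ∂ν := by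
          refine integral_mono_ae (hPi.sub hg).norm
            ((integrable_const _).add (hg.sub hhi).norm) ?_
          filter_upwards [hν] with x hx
          have h1 := abs_lt.1 (hP x hx)
          have h2 : |max (h x) 0 - max (g x) 0| ≤ |h x - g x| := abs_max_sub_max_le_abs _ _ _
          rw [max_eq_left (hg0 x), abs_sub_comm (h x)] at h2
          have h3 := abs_le.1 h2
          rw [Real.norm_eq_abs, Real.norm_eq_abs, abs_le]
          constructor <;> linarith [h1.1, h1.2, h3.1, h3.2]
      _ = ε / 2 + ∫ x, ‖g x - h x‖ ∂ν := by
          have hgh : Integrable (fun x => ‖g x - h x‖) ν := (hg.sub hhi).norm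
          rw [integral_add (integrable_const _) hgh]
          simp
      _ ≤ ε := by linarith

theorem exists_seq_pos_polynomial_tendsto (hν : ∀ᵐ x ∂ν, x ∈ Icc a b) (hg : Integrable g ν)
    (hg0 : ∀ x, 0 ≤ g x) :
    ∃ P : ℕ → ℝ[X], (∀ n, ∀ x ∈ Icc a b, 0 < (P n).eval x) ∧
      (∀ᵐ x ∂ν, Tendsto (fun n => (P n).eval x) atTop (𝓝 (g x))) ∧
      Tendsto (fun n => ∫ x, (P n).eval x ∂ν) atTop (𝓝 (∫ x, g x ∂ν)) := by
  choose P hpos hPi hP using fun n : ℕ => exists_pos_polynomial_integral_sub_le hν hg hg0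
    (Nat.one_div_pos_of_nat (α := ℝ) (n := n))
  have hz : Tendsto (fun n : ℕ => ENNReal.ofReal (1 / ((n : ℝ) + 1))) atTop (𝓝 0) := by
    simpa only [ENNReal.ofReal_zero] using
      ENNReal.tendsto_ofReal (tendsto_one_div_add_atTop_nhds_zero_nat (𝕜 := ℝ))
  have hL1 : Tendsto (fun n => eLpNorm ((fun x => (P n).eval x) - g) 1 ν) atTop (𝓝 0) := by
    refine tendsto_of_tendsto_of_tendsto_of_le_of_le tendsto_const_nhds hz
      (fun _ => zero_le) fun n => ?_
    rw [eLpNorm_one_eq_lintegral_enorm, ← ofReal_integral_norm_eq_lintegral_enorm ((hPi n).sub hg)]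
    exact ENNReal.ofReal_le_ofReal (hP n)
  obtain ⟨ns, hns, hae⟩ := (tendstoInMeasure_of_tendsto_eLpNorm one_ne_zero
    (fun n => (hPi n).1) hg.1 hL1).exists_seq_tendsto_ae
  refine ⟨fun n => P (ns n), fun n => hpos _, hae, ?_⟩
  exact (tendsto_integral_of_L1' g hg.1 (Eventually.of_forall hPi) hL1).comp hns.tendsto_atTop

end Approximation

theorem integral_map_coord {N : ℕ} (j : Fin N) {φ : ℝ → ℝ} (hφ : Measurable φ) :
    ∫ x, φ x ∂((sphereUniform N).map fun v => v.1 j) = ∫ v, φ (v.1 j) ∂(sphereUniform N) :=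
  integral_map (continuous_coord j).measurable.aemeasurable hφ.aestronglyMeasurable

theorem lintegral_prod_coord_le_of_ne_top {N : ℕ} (hN : 2 ≤ N) {f : Fin N → ℝ → ℝ}
    (hmeas : ∀ j, Measurable (f j)) (hpos : ∀ j x, 0 ≤ f j x)
    (hfin : ∀ j, ∫⁻ v : 𝕊 N, ENNReal.ofReal (f j (v.1 j)) ^ 2 ∂(sphereUniform N) ≠ ∞) :
    ∫⁻ v : 𝕊 N, ∏ j, ENNReal.ofReal (f j (v.1 j)) ∂(sphereUniform N) ≤
      ∏ j, (∫⁻ v : 𝕊 N, ENNReal.ofReal (f j (v.1 j)) ^ 2 ∂(sphereUniform N)) ^ ((1 : ℝ) / 2) := by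
  have := sphereUniform_isProbabilityMeasure hN
  have hcm : ∀ j : Fin N, Measurable fun v : 𝕊 N => v.1 j := fun j => (continuous_coord j).measurable
  have hsq : ∀ j (v : 𝕊 N), ENNReal.ofReal (f j (v.1 j)) ^ 2 = ENNReal.ofReal (f j (v.1 j) ^ 2) :=
    fun j v => (ENNReal.ofReal_pow (hpos j _) 2).symm
  simp only [hsq] at hfin ⊢
  have hint : ∀ j, Integrable (fun v : 𝕊 N => f j (v.1 j) ^ 2) (sphereUniform N) := fun j =>
    (lintegral_ofReal_ne_top_iff_integrable
      (((hmeas j).comp (hcm j)).pow_const 2).aestronglyMeasurable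
      (Eventually.of_forall fun v => sq_nonneg _)).1 (hfin j)
  have hprob : ∀ j : Fin N, IsProbabilityMeasure ((sphereUniform N).map fun v => v.1 j) :=
    fun j => Measure.isProbabilityMeasure_map (hcm j).aemeasurable
  choose P hP hae hlim using fun j => exists_seq_pos_polynomial_tendsto (a := -1) (b := 1)
    (ν := (sphereUniform N).map fun v => v.1 j) (g := fun x => f j x ^ 2)
    ((ae_map_iff (hcm j).aemeasurable measurableSet_Icc).2
      (Eventually.of_forall fun v => coord_mem_Icc v j))
    ((integrable_map_measure ((hmeas j).pow_const 2).aestronglyMeasurable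
      (hcm j).aemeasurable).2 (hint j)) (fun x => sq_nonneg _)
  simp only [integral_map_coord _ (P _ _).continuous.measurable,
    integral_map_coord _ ((hmeas _).pow_const 2)] at hlim
  have hae' : ∀ᵐ v ∂(sphereUniform N), ∀ j,
      Tendsto (fun n => (P j n).eval (v.1 j)) atTop (𝓝 (f j (v.1 j) ^ 2)) :=
    ae_all_iff.2 fun j => ae_of_ae_map (hcm j).aemeasurable (hae j)
  have hcont : ∀ n, Continuous fun v : 𝕊 N => ∏ j, √((P j n).eval (v.1 j)) := fun n =>
    continuous_finsetProd _ fun j _ => (continuous_eval_coord _ j).sqrt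
  calc ∫⁻ v : 𝕊 N, ∏ j, ENNReal.ofReal (f j (v.1 j)) ∂(sphereUniform N)
      = ∫⁻ v : 𝕊 N, liminf (fun n => ENNReal.ofReal (∏ j, √((P j n).eval (v.1 j)))) atTop
          ∂(sphereUniform N) := by
        refine lintegral_congr_ae ?_
        filter_upwards [hae'] with v hv
        rw [← ENNReal.ofReal_prod_of_nonneg fun j _ => hpos j _]
        refine (Tendsto.liminf_eq (ENNReal.tendsto_ofReal ?_)).symm
        refine tendsto_finsetProd _ fun j _ => ?_
        simpa only [Real.sqrt_sq (hpos j _)] using (hv j).sqrt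
    _ ≤ liminf (fun n => ∫⁻ v : 𝕊 N, ENNReal.ofReal (∏ j, √((P j n).eval (v.1 j)))
          ∂(sphereUniform N)) atTop :=
        lintegral_liminf_le fun n => (hcont n).measurable.ennreal_ofReal
    _ ≤ liminf (fun n => ENNReal.ofReal
          (∏ j, √(∫ v : 𝕊 N, (P j n).eval (v.1 j) ∂(sphereUniform N)))) atTop := by
        refine liminf_le_liminf (Eventually.of_forall fun n => ?_)
        rw [← ofReal_integral_eq_lintegral_ofReal ((hcont n).integrable_of_hasCompactSupport
          (HasCompactSupport.of_compactSpace _))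
          (Eventually.of_forall fun v => Finset.prod_nonneg fun _ _ => Real.sqrt_nonneg _)]
        exact ENNReal.ofReal_le_ofReal (integral_prod_sqrt_eval_le hN fun j => hP j n)
    _ = ENNReal.ofReal (∏ j, √(∫ v : 𝕊 N, f j (v.1 j) ^ 2 ∂(sphereUniform N))) :=
        (ENNReal.tendsto_ofReal (tendsto_finsetProd _ fun j _ => (hlim j).sqrt)).liminf_eq
    _ = _ := by
        rw [ENNReal.ofReal_prod_of_nonneg fun j _ => Real.sqrt_nonneg _]
        refine Finset.prod_congr rfl fun j _ => ?_
        rw [← ofReal_integral_eq_lintegral_ofReal (hint j)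
          (Eventually.of_forall fun v => sq_nonneg _), Real.sqrt_eq_rpow,
          ENNReal.ofReal_rpow_of_nonneg (integral_nonneg fun v => sq_nonneg _) (by norm_num)]

/-- spherical analogue of Young's inequality with `p = 2`. -/
theorem sphere_young_L2 (N : ℕ) (hN : 2 ≤ N) (f : Fin N → ℝ → ℝ)
    (hmeas : ∀ j, Measurable (f j)) (hpos : ∀ j x, 0 ≤ f j x) :
    ∫⁻ v, ∏ j, ENNReal.ofReal (f j ((v : EuclideanSpace ℝ (Fin N)) j)) ∂(sphereUniform N) ≤
      ∏ j, (∫⁻ v, ENNReal.ofReal (f j ((v : EuclideanSpace ℝ (Fin N)) j)) ^ 2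
        ∂(sphereUniform N)) ^ ((1 : ℝ) / 2) := by
  by_cases hfin : ∀ j, ∫⁻ v : 𝕊 N, ENNReal.ofReal (f j (v.1 j)) ^ 2 ∂(sphereUniform N) ≠ ∞
  · exact lintegral_prod_coord_le_of_ne_top hN hmeas hpos hfin
  push Not at hfin
  obtain ⟨i, hi⟩ := hfin
  by_cases hzero : ∃ j, ∫⁻ v : 𝕊 N, ENNReal.ofReal (f j (v.1 j)) ^ 2 ∂(sphereUniform N) = 0
  · obtain ⟨j, hj⟩ := hzero
    have hm : Measurable fun v : 𝕊 N => ENNReal.ofReal (f j (v.1 j)) ^ 2 :=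
      ((hmeas j).comp (continuous_coord j).measurable).ennreal_ofReal.pow_const 2
    rw [lintegral_eq_zero_iff hm] at hj
    refine le_of_eq_of_le (lintegral_eq_zero_of_ae_eq_zero ?_) zero_le
    filter_upwards [hj] with v hv
    exact Finset.prod_eq_zero (Finset.mem_univ j) (pow_eq_zero_iff two_ne_zero |>.1 hv)
  · push Not at hzero
    refine le_of_le_of_eq le_top (Eq.symm ?_)
    rw [← Finset.mul_prod_erase _ _ (Finset.mem_univ i), hi, ENNReal.top_rpow_of_pos (by norm_num)]
    refine ENNReal.top_mul (Finset.prod_ne_zero_iff.2 fun j _ => ?_)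
    rw [Ne, ENNReal.rpow_eq_zero_iff_of_pos (by norm_num)]
    exact hzero j
end

section
/- For each p < 2 and each N ≥ 2, there exists a nonnegative function f on [-1,1] with ‖f‖_{L^p(S^{N-1})} < ∞ (for each coordinate pullback) such that ∫_{S^{N-1}} ∏_{j=1}^N f(v_j) dμ = +∞. In particular, the spherical Young inequality fails for every p < 2 with any constant. -/
open MeasureTheory ENNReal

open Metric in
/-- Integration over the unit sphere as integration of the radial extension over the unit ball. -/
lemma lintegral_toSphere_eq_lintegral_ball {E : Type*} [NormedAddCommGroup E] [NormedSpace ℝ E]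
    [FiniteDimensional ℝ E] [MeasurableSpace E] [BorelSpace E] (μ : Measure E)
    [μ.IsAddHaarMeasure] {g : E → ℝ≥0∞} (hg : Measurable g) :
    ∫⁻ v, g v ∂μ.toSphere =
      Module.finrank ℝ E * ∫⁻ x in ball (0 : E) 1 \ {0}, g (‖x‖⁻¹ • x) ∂μ := by
  have hφ : Measurable fun x : E ↦ ‖x‖⁻¹ • x := by fun_prop
  have hmap : μ.toSphere.map Subtype.val = (Module.finrank ℝ E : ℝ≥0∞) •
      (μ.restrict (ball (0 : E) 1 \ {0})).map (fun x : E ↦ ‖x‖⁻¹ • x) := by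
    ext s hs
    rw [Measure.map_apply measurable_subtype_coe hs,
      μ.toSphere_apply' (measurable_subtype_coe hs), Measure.smul_apply,
      Measure.map_apply hφ hs, Measure.restrict_apply (hφ hs), smul_eq_mul]
    congr 2
    ext x
    simp only [Set.mem_smul, Set.mem_inter_iff, Set.mem_preimage, Set.mem_sdiff, mem_ball,
      dist_zero_right, Set.mem_singleton_iff]
    constructor
    · rintro ⟨r, hr, -, ⟨v, hv, rfl⟩, rfl⟩
      have hv1 : ‖(v : E)‖ = 1 := by simp
      have hn : ‖r • (v : E)‖ = r := by rw [norm_smul, hv1, mul_one, Real.norm_of_nonneg hr.1.le]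
      refine ⟨?_, ?_, ?_⟩
      · rw [hn, smul_smul, inv_mul_cancel₀ hr.1.ne', one_smul]
        exact hv
      · rw [hn]
        exact hr.2
      · rw [← norm_eq_zero, hn]
        exact hr.1.ne'
    · rintro ⟨hs, h1, h0⟩
      have hpos : 0 < ‖x‖ := norm_pos_iff.2 h0
      refine ⟨‖x‖, ⟨hpos, h1⟩, ‖x‖⁻¹ • x, ⟨⟨‖x‖⁻¹ • x, ?_⟩, hs, rfl⟩, ?_⟩
      · simp [norm_smul, hpos.ne']
      · rw [smul_smul, mul_inv_cancel₀ hpos.ne', one_smul]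
  rw [← lintegral_map hg measurable_subtype_coe, hmap, lintegral_smul_measure,
    lintegral_map hg hφ, smul_eq_mul]

/-- The product function `∏ |xᵢ| ^ r` is integrable on the cube `(-1, 1)ⁿ` when `-1 < r`. -/
lemma lintegral_prod_abs_rpow_lt_top {ι : Type*} [Fintype ι] {r : ℝ} (hr : -1 < r) :
    ∫⁻ x in {x : EuclideanSpace ℝ ι | ∀ i, x i ∈ Set.Ioo (-1) 1},
      ENNReal.ofReal (∏ i, |x i| ^ r) < ⊤ := by
  have h1 : IntegrableOn (fun x : ℝ ↦ |x| ^ r) (Set.Ioo (-1) 1) := by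
    have hpos : IntegrableOn (fun x : ℝ ↦ |x| ^ r) (Set.Ioo 0 1) :=
      ((intervalIntegral.integrableOn_Ioo_rpow_iff one_pos).2 hr).congr_fun
        (fun x hx ↦ by simp [abs_of_pos hx.1]) measurableSet_Ioo
    have hneg : IntegrableOn (fun x : ℝ ↦ |x| ^ r) (Set.Ioo (-1) 0) := by
      have := hpos.comp_neg
      simpa using this
    have := (hneg.union hpos).union (integrableOn_singleton (x := (0 : ℝ)) (by simp)
      (hx := by rw [Real.volume_singleton]; simp))
    refine this.mono_set fun x hx ↦ ?_
    rcases lt_trichotomy x 0 with h | h | h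
    · exact Or.inl (Or.inl ⟨hx.1, h⟩)
    · exact Or.inr h
    · exact Or.inl (Or.inr ⟨h, hx.2⟩)
  have h2 : Integrable (fun x : ι → ℝ ↦ ∏ i, |x i| ^ r)
      (volume.restrict (Set.univ.pi fun _ ↦ Set.Ioo (-1) 1)) := by
    rw [volume_pi, Measure.restrict_pi_pi]
    exact Integrable.fintype_prod fun _ ↦ h1
  have h3 := (PiLp.volume_preserving_ofLp ι).setLIntegral_comp_preimage
    (s := Set.univ.pi fun _ ↦ Set.Ioo (-1 : ℝ) 1)
    (f := fun x ↦ ENNReal.ofReal (∏ i, |x i| ^ r))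
    (MeasurableSet.univ_pi fun _ ↦ measurableSet_Ioo) (by fun_prop)
  have hset : {x : EuclideanSpace ℝ ι | ∀ i, x i ∈ Set.Ioo (-1) 1} =
      WithLp.ofLp ⁻¹' Set.univ.pi fun _ ↦ Set.Ioo (-1) 1 := by
    ext x
    simp only [Set.mem_ofPred_eq, Set.mem_preimage, Set.mem_univ_pi]
  rw [hset]
  exact h3.trans_lt h2.lintegral_lt_top

/-- A function on `[-1, 1]` with power singularities at `0` and at `±1`. -/
noncomputable def endpointSingular (α : ℝ) (m : ℕ) (t : ℝ) : ℝ :=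
  max (|t| ^ (-α)) ((|1 - t ^ 2| ^ (-α / 2)) ^ m)

lemma measurable_endpointSingular (α : ℝ) (m : ℕ) : Measurable (endpointSingular α m) := by
  unfold endpointSingular
  fun_prop

lemma endpointSingular_nonneg (α : ℝ) (m : ℕ) (t : ℝ) : 0 ≤ endpointSingular α m t :=
  le_max_of_le_left (by positivity)

lemma endpointSingular_le_prod {ι : Type*} [Fintype ι] {α : ℝ} (hα : 0 ≤ α) {v : ι → ℝ}
    (hv : ∑ i, v i ^ 2 = 1) (h0 : ∀ i, v i ≠ 0) (j : ι) :
    endpointSingular α (Fintype.card ι - 1) (v j) ≤ ∏ i, |v i| ^ (-α) := by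
  classical
  have hle : ∀ i, |v i| ≤ 1 := fun i ↦ by
    rw [← sq_le_one_iff_abs_le_one, ← hv]
    exact Finset.single_le_sum (f := fun i ↦ v i ^ 2) (fun _ _ ↦ sq_nonneg _) (Finset.mem_univ i)
  have hone : ∀ i, 1 ≤ |v i| ^ (-α) := fun i ↦
    Real.one_le_rpow_of_pos_of_le_one_of_nonpos (abs_pos.2 (h0 i)) (hle i) (by linarith)
  have hprod : 1 ≤ ∏ i ∈ Finset.univ.erase j, |v i| ^ (-α) :=
    Finset.prod_const_one.symm.le.trans
      (Finset.prod_le_prod (fun _ _ ↦ zero_le_one) fun i _ ↦ hone i)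
  rw [← Finset.mul_prod_erase _ _ (Finset.mem_univ j)]
  refine max_le (le_mul_of_one_le_right (by positivity) hprod) ?_
  refine le_trans ?_ (le_mul_of_one_le_left (by positivity) (hone j))
  have hcard : Fintype.card ι - 1 = (Finset.univ.erase j).card := by
    rw [Finset.card_erase_of_mem (Finset.mem_univ j), Finset.card_univ]
  rw [hcard, ← Finset.prod_const]
  refine Finset.prod_le_prod (fun _ _ ↦ by positivity) fun i hi ↦ ?_
  have hsum : v i ^ 2 ≤ 1 - v j ^ 2 := by
    rw [← hv, ← Finset.add_sum_erase _ _ (Finset.mem_univ j), add_sub_cancel_left]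
    exact Finset.single_le_sum (f := fun i ↦ v i ^ 2) (fun _ _ ↦ sq_nonneg _) hi
  have hpos : 0 < v i ^ 2 := by have := h0 i; positivity
  calc |1 - v j ^ 2| ^ (-α / 2) ≤ (v i ^ 2) ^ (-α / 2) :=
        Real.rpow_le_rpow_of_nonpos hpos (hsum.trans (le_abs_self _)) (by linarith)
    _ = |v i| ^ (-α) := by
        rw [← sq_abs, ← Real.rpow_natCast, ← Real.rpow_mul (abs_nonneg _)]
        congr 1
        push_cast
        ring

lemma EuclideanSpace.sum_sq_inv_norm_smul {ι : Type*} [Fintype ι] {x : EuclideanSpace ℝ ι}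
    (hx : x ≠ 0) : ∑ i, (‖x‖⁻¹ • x) i ^ 2 = 1 := by
  rw [← EuclideanSpace.real_norm_sq_eq, norm_smul, norm_inv, norm_norm,
    inv_mul_cancel₀ (norm_ne_zero_iff.2 hx), one_pow]

lemma EuclideanSpace.ae_forall_ne_zero {ι : Type*} [Fintype ι] :
    ∀ᵐ x : EuclideanSpace ℝ ι, ∀ i, x i ≠ 0 :=
  (PiLp.volume_preserving_ofLp ι).quasiMeasurePreserving.ae
    (ae_all_iff.2 fun i ↦ Measure.ae_eval_ne _ i 0)

open Metric in
/-- Each coordinate pullback of the singular function is in `L^p` when `α p < 1`. -/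
lemma lintegral_toSphere_endpointSingular_rpow_lt_top {ι : Type*} [Fintype ι] {α p : ℝ}
    (hα : 0 ≤ α) (hp : 0 ≤ p) (hαp : α * p < 1) (j : ι) :
    ∫⁻ v, ENNReal.ofReal (endpointSingular α (Fintype.card ι - 1)
        ((v : EuclideanSpace ℝ ι) j)) ^ p
      ∂(volume : Measure (EuclideanSpace ℝ ι)).toSphere < ⊤ := by
  have hmeas := measurable_endpointSingular α (Fintype.card ι - 1)
  rw [lintegral_toSphere_eq_lintegral_ball volume (g := fun x : EuclideanSpace ℝ ι ↦
    ENNReal.ofReal (endpointSingular α (Fintype.card ι - 1) (x j)) ^ p) (by fun_prop)]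
  refine ENNReal.mul_lt_top (ENNReal.natCast_lt_top _) ?_
  refine lt_of_le_of_lt ?_ (lintegral_prod_abs_rpow_lt_top (ι := ι) (r := -(α * p)) (by linarith))
  refine le_trans (setLIntegral_mono_ae' (g := fun x : EuclideanSpace ℝ ι ↦
    ENNReal.ofReal (∏ i, |x i| ^ (-(α * p))))
    (MeasurableSet.diff measurableSet_ball (measurableSet_singleton _)) ?_) (lintegral_mono_set ?_)
  · filter_upwards [EuclideanSpace.ae_forall_ne_zero] with x hx0 hx
    have hpos : 0 < ‖x‖ := norm_pos_iff.2 hx.2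
    have hlt : ‖x‖ < 1 := by simpa using hx.1
    rw [ENNReal.ofReal_rpow_of_nonneg (endpointSingular_nonneg _ _ _) hp]
    refine ENNReal.ofReal_le_ofReal ?_
    have h := endpointSingular_le_prod hα (EuclideanSpace.sum_sq_inv_norm_smul hx.2)
      (fun i ↦ mul_ne_zero (inv_ne_zero hpos.ne') (hx0 i)) j
    calc _ ≤ (∏ i, |(‖x‖⁻¹ • x) i| ^ (-α)) ^ p :=
          Real.rpow_le_rpow (endpointSingular_nonneg _ _ _) h hp
      _ = ∏ i, |(‖x‖⁻¹ • x) i| ^ (-(α * p)) := by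
          rw [← Real.finsetProd_rpow _ _ fun _ _ ↦ by positivity]
          refine Finset.prod_congr rfl fun i _ ↦ ?_
          rw [← Real.rpow_mul (abs_nonneg _), neg_mul]
      _ ≤ ∏ i, |x i| ^ (-(α * p)) := by
          refine Finset.prod_le_prod (fun _ _ ↦ by positivity) fun i _ ↦ ?_
          refine Real.rpow_le_rpow_of_nonpos (abs_pos.2 (hx0 i)) ?_
            (neg_nonpos.2 (mul_nonneg hα hp))
          rw [PiLp.smul_apply, smul_eq_mul, abs_mul, abs_of_pos (inv_pos.2 hpos)]
          exact le_mul_of_one_le_left (abs_nonneg _) ((one_le_inv₀ hpos).2 hlt.le)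
  · intro x hx i
    have := (PiLp.norm_apply_le x i).trans_lt (by simpa using hx.1 : ‖x‖ < 1)
    exact abs_lt.1 this

/-- Lower bound for the product at a point of the unit sphere close to a pole. -/
lemma rpow_pow_le_prod_endpointSingular {ι : Type*} [Fintype ι] [DecidableEq ι]
    {α ε : ℝ} (hα : 0 ≤ α) {v : ι → ℝ} {j : ι} (hj : 0 < 1 - v j ^ 2)
    (hjε : 1 - v j ^ 2 ≤ ε ^ 2) (hε : 0 < ε) (hv : ∀ i, i ≠ j → 0 < v i ∧ v i ≤ ε) :
    ((ε ^ (-α)) ^ (Fintype.card ι - 1)) ^ 2 ≤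
      ∏ i, endpointSingular α (Fintype.card ι - 1) (v i) := by
  rw [← Finset.mul_prod_erase _ _ (Finset.mem_univ j), sq]
  have hε2 : (ε ^ 2) ^ (-α / 2) = ε ^ (-α) := by
    rw [← Real.rpow_natCast, ← Real.rpow_mul hε.le]
    congr 1
    push_cast
    ring
  refine mul_le_mul ?_ ?_ (by positivity) (endpointSingular_nonneg _ _ _)
  · refine le_max_of_le_right (pow_le_pow_left₀ (by positivity) ?_ _)
    rw [← hε2, abs_of_pos hj]
    exact Real.rpow_le_rpow_of_nonpos hj hjε (by linarith)
  · have hcard : (Finset.univ.erase j).card = Fintype.card ι - 1 := by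
      rw [Finset.card_erase_of_mem (Finset.mem_univ j), Finset.card_univ]
    calc (ε ^ (-α)) ^ (Fintype.card ι - 1) = ∏ _i ∈ Finset.univ.erase j, ε ^ (-α) := by
          rw [Finset.prod_const, hcard]
      _ ≤ _ := by
          refine Finset.prod_le_prod (fun _ _ ↦ by positivity) fun i hi ↦ ?_
          obtain ⟨h0, h1⟩ := hv i (Finset.ne_of_mem_erase hi)
          refine le_max_of_le_left ?_
          rw [abs_of_pos h0]
          exact Real.rpow_le_rpow_of_nonpos h0 h1 (by linarith)

/-- A thin box whose radial projection is a small neighbourhood of a pole. -/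
def poleBox {ι : Type*} [DecidableEq ι] (j : ι) (δ : ℝ) : Set (EuclideanSpace ℝ ι) :=
  {x | ∀ i, x i ∈ if i = j then Set.Ioo (1 / 4 : ℝ) (1 / 2) else Set.Ioo 0 δ}

lemma poleBox_eq_preimage {ι : Type*} [DecidableEq ι] (j : ι) (δ : ℝ) :
    poleBox j δ = WithLp.ofLp ⁻¹'
      Set.univ.pi fun i ↦ if i = j then Set.Ioo (1 / 4 : ℝ) (1 / 2) else Set.Ioo 0 δ := by
  ext x
  simp only [poleBox, Set.mem_ofPred_eq, Set.mem_preimage, Set.mem_univ_pi]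

lemma measurableSet_pi_poleBox {ι : Type*} [Fintype ι] [DecidableEq ι] (j : ι) (δ : ℝ) :
    MeasurableSet (Set.univ.pi fun i : ι ↦
      if i = j then Set.Ioo (1 / 4 : ℝ) (1 / 2) else Set.Ioo 0 δ) :=
  MeasurableSet.univ_pi fun i ↦ by split_ifs <;> exact measurableSet_Ioo

lemma measurableSet_poleBox {ι : Type*} [Fintype ι] [DecidableEq ι] (j : ι) (δ : ℝ) :
    MeasurableSet (poleBox j δ) := by
  rw [poleBox_eq_preimage]
  exact (PiLp.volume_preserving_ofLp ι).measurable (measurableSet_pi_poleBox j δ)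

lemma volume_poleBox {ι : Type*} [Fintype ι] [DecidableEq ι] (j : ι) (δ : ℝ) :
    volume (poleBox j δ) =
      ENNReal.ofReal (1 / 4) * ENNReal.ofReal δ ^ (Fintype.card ι - 1) := by
  have hcard : (Finset.univ.erase j).card = Fintype.card ι - 1 := by
    rw [Finset.card_erase_of_mem (Finset.mem_univ j), Finset.card_univ]
  rw [poleBox_eq_preimage]
  refine ((PiLp.volume_preserving_ofLp ι).measure_preimage
    (measurableSet_pi_poleBox j δ).nullMeasurableSet).trans ?_
  rw [volume_pi_pi, ← Finset.mul_prod_erase _ _ (Finset.mem_univ j), if_pos rfl, Real.volume_Ioo,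
    ← hcard, ← Finset.prod_const]
  congr 1
  · norm_num
  · refine Finset.prod_congr rfl fun i hi ↦ ?_
    rw [if_neg (Finset.ne_of_mem_erase hi), Real.volume_Ioo, sub_zero]

/-- Geometry of the thin box: it lies in the punctured unit ball and projects near the pole. -/
lemma norm_lt_one_and_near_pole_of_mem_poleBox {ι : Type*} [Fintype ι] [DecidableEq ι]
    [Nontrivial ι] {j : ι} {δ : ℝ} (hδ1 : 4 * Fintype.card ι * δ ≤ 1)
    {x : EuclideanSpace ℝ ι} (hx : x ∈ poleBox j δ) :
    ‖x‖ < 1 ∧ x ≠ 0 ∧ 0 < 1 - (‖x‖⁻¹ • x) j ^ 2 ∧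
      1 - (‖x‖⁻¹ • x) j ^ 2 ≤ (4 * Fintype.card ι * δ) ^ 2 ∧
      ∀ i, i ≠ j → 0 < (‖x‖⁻¹ • x) i ∧ (‖x‖⁻¹ • x) i ≤ 4 * Fintype.card ι * δ := by
  have hxj : 1 / 4 < x j ∧ x j < 1 / 2 := by simpa using hx j
  have hxi : ∀ i, i ≠ j → 0 < x i ∧ x i < δ := fun i hi ↦ by simpa [hi] using hx i
  have hne : x ≠ 0 := by
    rintro rfl
    norm_num at hxj
  have hpos : 0 < ‖x‖ := norm_pos_iff.2 hne
  have hinv : ‖x‖⁻¹ ≤ 4 := by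
    have h : x j ≤ ‖x‖ := (le_abs_self _).trans (PiLp.norm_apply_le x j)
    rw [inv_le_comm₀ hpos (by norm_num)]
    linarith
  obtain ⟨k, hk⟩ := exists_ne j
  have hδ : 0 < δ := (hxi k hk).1.trans (hxi k hk).2
  have hcard2 : (1 : ℝ) ≤ Fintype.card ι := by exact_mod_cast Fintype.card_pos
  have hcard : ((Finset.univ.erase j).card : ℝ) ≤ Fintype.card ι := by
    exact_mod_cast Finset.card_le_univ _
  set n := (Fintype.card ι : ℝ)
  have hsum_pos : 0 < ∑ i ∈ Finset.univ.erase j, x i ^ 2 :=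
    Finset.sum_pos (fun i hi ↦ by have := (hxi i (Finset.ne_of_mem_erase hi)).1; positivity)
      ⟨k, by simpa using hk⟩
  have hsum_le : ∑ i ∈ Finset.univ.erase j, x i ^ 2 ≤ n * δ ^ 2 :=
    calc _ ≤ (Finset.univ.erase j).card • δ ^ 2 := Finset.sum_le_card_nsmul _ _ _ fun i hi ↦ by
          obtain ⟨h0, h1⟩ := hxi i (Finset.ne_of_mem_erase hi)
          exact pow_le_pow_left₀ h0.le h1.le 2
      _ ≤ n * δ ^ 2 := by
          rw [nsmul_eq_mul]
          gcongr
  have hnorm : ‖x‖ ^ 2 = x j ^ 2 + ∑ i ∈ Finset.univ.erase j, x i ^ 2 := by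
    rw [EuclideanSpace.real_norm_sq_eq, Finset.add_sum_erase _ (fun i ↦ x i ^ 2) (Finset.mem_univ j)]
  have hδn : n * δ ^ 2 ≤ (n * δ) ^ 2 := by nlinarith [sq_nonneg δ]
  have hdef : 1 - (‖x‖⁻¹ • x) j ^ 2 = ‖x‖⁻¹ ^ 2 * ∑ i ∈ Finset.univ.erase j, x i ^ 2 := by
    rw [PiLp.smul_apply, smul_eq_mul, eq_sub_of_add_eq' hnorm.symm]
    field_simp
  refine ⟨?_, hne, ?_, ?_, fun i hi ↦ ?_⟩
  · have : ‖x‖ ^ 2 < 1 := by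
      have : 0 ≤ n * δ := by positivity
      nlinarith
    exact (sq_lt_one_iff₀ hpos.le).1 this
  · rw [hdef]
    positivity
  · rw [hdef]
    calc ‖x‖⁻¹ ^ 2 * ∑ i ∈ Finset.univ.erase j, x i ^ 2 ≤ 4 ^ 2 * (n * δ) ^ 2 := by
          gcongr
          exact hsum_le.trans hδn
      _ = (4 * n * δ) ^ 2 := by ring
  · obtain ⟨h0, h1⟩ := hxi i hi
    rw [PiLp.smul_apply, smul_eq_mul]
    refine ⟨by positivity, ?_⟩
    calc ‖x‖⁻¹ * x i ≤ 4 * δ := by gcongr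
      _ ≤ 4 * n * δ := by nlinarith

open Metric Filter Topology in
/-- The product of the coordinate pullbacks is not integrable when `1 / 2 < α`. -/
lemma lintegral_toSphere_prod_endpointSingular_eq_top {ι : Type*} [Fintype ι] [Nontrivial ι]
    {α : ℝ} (hα : 1 / 2 < α) :
    ∫⁻ v, ∏ i, ENNReal.ofReal (endpointSingular α (Fintype.card ι - 1)
        ((v : EuclideanSpace ℝ ι) i))
      ∂(volume : Measure (EuclideanSpace ℝ ι)).toSphere = ⊤ := by
  classical
  have hmeas := measurable_endpointSingular α (Fintype.card ι - 1)
  rw [lintegral_toSphere_eq_lintegral_ball volume (g := fun x : EuclideanSpace ℝ ι ↦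
    ∏ i, ENNReal.ofReal (endpointSingular α (Fintype.card ι - 1) (x i))) (by fun_prop)]
  refine ENNReal.mul_eq_top.2 (Or.inl ⟨by simp, ?_⟩)
  obtain ⟨j⟩ : Nonempty ι := inferInstance
  set m := Fintype.card ι - 1 with hm
  have hm0 : m ≠ 0 := by have := Fintype.one_lt_card (α := ι); omega
  have hn : (0 : ℝ) < Fintype.card ι := by exact_mod_cast Fintype.card_pos
  set n := (Fintype.card ι : ℝ)
  have hbound : ∀ ε ∈ Set.Ioo (0 : ℝ) 1,
      ENNReal.ofReal ((1 / 4 * (1 / (4 * n)) ^ m) * (ε ^ (-(2 * α - 1))) ^ m) ≤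
        ∫⁻ x in ball (0 : EuclideanSpace ℝ ι) 1 \ {0},
          ∏ i, ENNReal.ofReal (endpointSingular α m ((‖x‖⁻¹ • x) i)) := by
    rintro ε ⟨hε, hε1⟩
    have hδ : 4 * n * (ε / (4 * n)) = ε := by field_simp
    calc _ = ENNReal.ofReal (((ε ^ (-α)) ^ m) ^ 2) * volume (poleBox j (ε / (4 * n))) := by
          rw [volume_poleBox, ← ENNReal.ofReal_pow (by positivity),
            ← ENNReal.ofReal_mul (by positivity), ← ENNReal.ofReal_mul (by positivity)]
          congr 1
          have : ε ^ (-(2 * α - 1)) = (ε ^ (-α)) ^ 2 * ε := by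
            rw [← Real.rpow_natCast, ← Real.rpow_mul hε.le, ← Real.rpow_add_one hε.ne']
            congr 1
            push_cast
            ring
          rw [this, ← hm]
          ring
      _ = ∫⁻ _ in poleBox j (ε / (4 * n)), ENNReal.ofReal (((ε ^ (-α)) ^ m) ^ 2) := by
          rw [setLIntegral_const]
      _ ≤ ∫⁻ x in poleBox j (ε / (4 * n)),
          ∏ i, ENNReal.ofReal (endpointSingular α m ((‖x‖⁻¹ • x) i)) := by
          refine setLIntegral_mono' (measurableSet_poleBox _ _) fun x hx ↦ ?_
          obtain ⟨-, -, h1, h2, h3⟩ :=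
            norm_lt_one_and_near_pole_of_mem_poleBox (hδ.le.trans hε1.le) hx
          rw [← ENNReal.ofReal_prod_of_nonneg fun _ _ ↦ endpointSingular_nonneg _ _ _]
          rw [hδ] at h2
          exact ENNReal.ofReal_le_ofReal
            (rpow_pow_le_prod_endpointSingular (by linarith) h1 h2 hε
              fun i hi ↦ (h3 i hi).imp_right fun h ↦ h.trans_eq hδ)
      _ ≤ _ := lintegral_mono_set fun x hx ↦ by
          obtain ⟨h1, h0, -⟩ :=
            norm_lt_one_and_near_pole_of_mem_poleBox (hδ.le.trans hε1.le) hx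
          exact ⟨by simpa using h1, h0⟩
  have hlim : Tendsto (fun ε : ℝ ↦
      ENNReal.ofReal ((1 / 4 * (1 / (4 * n)) ^ m) * (ε ^ (-(2 * α - 1))) ^ m)) (𝓝[>] 0) (𝓝 ⊤) := by
    refine ENNReal.tendsto_ofReal_nhds_top.2 ?_
    exact ((tendsto_pow_atTop hm0).comp
      (tendsto_rpow_neg_nhdsGT_zero (by linarith))).const_mul_atTop (by positivity)
  exact top_le_iff.1 (le_of_tendsto hlim
    (mem_of_superset (Ioo_mem_nhdsGT one_pos) hbound))

/-- for every `p < 2` the spherical Young inequality fails with any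
constant: there is a nonnegative `f` on `[-1,1]` with finite `L^p` norm (for each
coordinate pullback) whose product integral over the sphere diverges. -/
theorem sphere_young_fails_below_two (p : ℝ) (hp : 0 < p) (hp2 : p < 2)
    (N : ℕ) (hN : 2 ≤ N) :
    ∃ f : ℝ → ℝ, Measurable f ∧ (∀ x, 0 ≤ f x) ∧
      (∀ j : Fin N,
        ∫⁻ v, ENNReal.ofReal (f ((v : EuclideanSpace ℝ (Fin N)) j)) ^ p
          ∂(sphereUniform N) < ⊤) ∧
      ∫⁻ v, ∏ j, ENNReal.ofReal (f ((v : EuclideanSpace ℝ (Fin N)) j))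
          ∂(sphereUniform N) = ⊤ := by
  have : Nontrivial (Fin N) := Fin.nontrivial_iff_two_le.2 hN
  have : Nontrivial (EuclideanSpace ℝ (Fin N)) :=
    Module.nontrivial_of_finrank_pos (R := ℝ) (by rw [finrank_euclideanSpace_fin]; omega)
  have hinv : ((volume : Measure (EuclideanSpace ℝ (Fin N))).toSphere Set.univ)⁻¹ < ⊤ :=
    ENNReal.inv_lt_top.2 <| pos_iff_ne_zero.2 <|
      Measure.measure_univ_ne_zero.2 (Measure.toSphere_ne_zero _)
  have hαp : (1 / 4 + 1 / (2 * p)) * p < 1 := by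
    have : (1 / 4 + 1 / (2 * p)) * p = p / 4 + 1 / 2 := by field_simp
    linarith
  have hα : 1 / 2 < 1 / 4 + 1 / (2 * p) := by
    have : 1 / 4 < 1 / (2 * p) := one_div_lt_one_div_of_lt (by positivity) (by linarith)
    linarith
  refine ⟨endpointSingular (1 / 4 + 1 / (2 * p)) (Fintype.card (Fin N) - 1),
    measurable_endpointSingular _ _, endpointSingular_nonneg _ _, fun j ↦ ?_, ?_⟩
  · rw [sphereUniform, lintegral_smul_measure]
    exact ENNReal.mul_lt_top hinv
      (lintegral_toSphere_endpointSingular_rpow_lt_top (by positivity) hp.le hαp j)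
  · rw [sphereUniform, lintegral_smul_measure,
      lintegral_toSphere_prod_endpointSingular_eq_top hα, smul_eq_mul]
    exact ENNReal.mul_top (ENNReal.inv_ne_zero.2 (measure_ne_top _ _))
end
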